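/- Fix a pattern σ ∈ S_k, μ ∈ ℳ and θ ∈ ℝ, and define I_{σ,μ,θ} : 𝒫 → [0,∞] by I_{σ,μ,θ}(γ) := inf_{ν∈ℳ : 𝒪(ν)=γ} { D(ν|μ) − θ t_σ(ν) } − inf_{ν∈ℳ} { D(ν|μ) − θ t_σ(ν) } if γ ∈ ℳ̃, and I_{σ,μ,θ}(γ) := ∞ otherwise. Then I_{σ,μ,θ} is a good rate function, and the Gibbs random permutations satisfy a large deviation principle with speed n and rate I_{σ,μ,θ}: for every Borel set A ⊆ 𝒫, −inf_{γ∈A°} I_{σ,μ,θ}(γ) ≤ liminf_{n→∞} (1/n) log P(Em(π_{n,σ,μ,θ}) ∈ A) ≤ limsup_{n→∞} (1/n) log P(Em(π_{n,σ,μ,θ}) ∈ A) ≤ −inf_{γ∈Ā} I_{σ,μ,θ}(γ). -/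

import Mathlib

open MeasureTheory Filter Topology
open scoped ENNReal

noncomputable section

/-- The plane `ℝ²`, carrier for measures on the unit square. -/
abbrev Ω2 : Type := ℝ × ℝ

/-- The unit square `[0,1]² ⊆ ℝ²`. -/
def unitSq : Set Ω2 := Set.Icc (0 : ℝ) 1 ×ˢ Set.Icc (0 : ℝ) 1

/-- Lebesgue measure on the unit square. -/
def lebSq : Measure Ω2 := volume.restrict unitSq

/-- `𝒫`: Borel probability measures concentrated on the unit square. -/
def Pcal : Set (ProbabilityMeasure Ω2) := {μ | (μ : Measure Ω2) unitSq = 1}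

/-- `ℳ`: members of `𝒫` whose two coordinate marginals are atomless
(equivalently, have continuous CDFs). -/
def Mcal : Set (ProbabilityMeasure Ω2) :=
  {μ | μ ∈ Pcal ∧ (∀ x : ℝ, (μ : Measure Ω2).map Prod.fst {x} = 0) ∧
      ∀ y : ℝ, (μ : Measure Ω2).map Prod.snd {y} = 0}

/-- The uniform distribution on `[0,1]`. -/
def unif01 : Measure ℝ := volume.restrict (Set.Icc (0 : ℝ) 1)

/-- `ℳ̃`: permutons, i.e. members of `𝒫` with both marginals uniform on `[0,1]`. -/
def Mtilde : Set (ProbabilityMeasure Ω2) :=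
  {μ | μ ∈ Pcal ∧ (μ : Measure Ω2).map Prod.fst = unif01 ∧
      (μ : Measure Ω2).map Prod.snd = unif01}

open scoped Classical in
/-- `h_σ`: indicator that the `k` points induce the pattern `σ`. -/
def hPat {k : ℕ} (σ : Equiv.Perm (Fin k)) (z : Fin k → Ω2) : ℝ :=
  if ∃ τ : Equiv.Perm (Fin k),
      StrictMono (fun i => (z (τ i)).1) ∧ StrictMono (fun i => (z (τ (σ⁻¹ i))).2)
  then 1 else 0

/-- Pattern density `t_σ(ν) = ∫ h_σ dν^{⊗k}`. -/
def tPat {k : ℕ} (σ : Equiv.Perm (Fin k)) (ν : Measure Ω2) : ℝ :=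
  ∫ z, hPat σ z ∂(Measure.pi fun _ : Fin k => ν)

open scoped Classical in
/-- The permutation induced by `n` labelled points of `ℝ²` (junk value `1` if the
coordinates are not in generic position). -/
def inducedPerm {n : ℕ} (z : Fin n → Ω2) : Equiv.Perm (Fin n) :=
  if h : ∃ σ : Equiv.Perm (Fin n), hPat σ z = 1 then h.choose else 1

/-- Empirical measure `Em(π) = (1/n) ∑ δ_{(i/n, π(i)/n)}` of a permutation, as a measure. -/
def EmM {n : ℕ} (π : Equiv.Perm (Fin n)) : Measure Ω2 :=
  (n : ℝ≥0∞)⁻¹ • ∑ i : Fin n, Measure.dirac ((((i : ℕ) + 1 : ℝ)) / n, (((π i : ℕ) + 1 : ℝ)) / n)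

open scoped Classical in
/-- Empirical measure of a permutation as a probability measure (junk value for `n = 0`). -/
def EmP {n : ℕ} (π : Equiv.Perm (Fin n)) : ProbabilityMeasure Ω2 :=
  if h : IsProbabilityMeasure (EmM π) then ⟨EmM π, h⟩
  else ⟨Measure.dirac 0, by infer_instance⟩

/-- `t_σ(π) := t_σ(Em(π))`. -/
def tPerm {k n : ℕ} (σ : Equiv.Perm (Fin k)) (π : Equiv.Perm (Fin n)) : ℝ := tPat σ (EmM π)

open scoped Classical in
/-- Kullback–Leibler divergence `D(ν|μ) ∈ [0,∞]`; for probability measures with `ν ≪ μ`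
it equals `∫ log(dν/dμ) dν`, written here through the nonnegative integrand
`g log g + 1 - g` of the density `g = dν/dμ` (the correction `∫ (1-g) dμ = 0`). -/
def KL (ν μ : Measure Ω2) : ℝ≥0∞ :=
  if ν ≪ μ then
    ∫⁻ z, ENNReal.ofReal ((ν.rnDeriv μ z).toReal * Real.log ((ν.rnDeriv μ z).toReal)
      + 1 - (ν.rnDeriv μ z).toReal) ∂μ
  else ∞

/-- CDF of the first marginal. -/
def cdfX (μ : Measure Ω2) (x : ℝ) : ℝ := (μ {p : Ω2 | p.1 ≤ x}).toReal

/-- CDF of the second marginal. -/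
def cdfY (μ : Measure Ω2) (y : ℝ) : ℝ := (μ {p : Ω2 | p.2 ≤ y}).toReal

/-- The map `𝒪`: pushforward of `μ` under `(x,y) ↦ (F₁(x), F₂(y))`. -/
def Omap (μ : Measure Ω2) : Measure Ω2 := μ.map fun p => (cdfX μ p.1, cdfY μ p.2)

/-- The product measure `μ^{⊗n}` governing `n` i.i.d. samples. -/
def pmeas (μ : Measure Ω2) (n : ℕ) : Measure (Fin n → Ω2) := Measure.pi fun _ => μ

/-- Log-partition function `F_n(σ,μ,θ) = log E[exp(nθ t_σ(π_{n,μ}))]`. -/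
def Fn {k : ℕ} (σ : Equiv.Perm (Fin k)) (μ : Measure Ω2) (θ : ℝ) (n : ℕ) : ℝ :=
  Real.log (∫ z, Real.exp (n * θ * tPerm σ (inducedPerm z)) ∂pmeas μ n)

/-- The Gibbs measure `Q_{n,σ,μ,θ}` on `([0,1]²)ⁿ`. -/
def Qgibbs {k : ℕ} (σ : Equiv.Perm (Fin k)) (μ : Measure Ω2) (θ : ℝ) (n : ℕ) :
    Measure (Fin n → Ω2) :=
  (pmeas μ n).withDensity fun z =>
    ENNReal.ofReal (Real.exp (n * θ * tPerm σ (inducedPerm z) - Fn σ μ θ n))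

/-- `F(σ,μ,θ) = sup_{ν ∈ ℳ} { θ t_σ(ν) − D(ν|μ) }`, valued in `EReal`. -/
def Fsup {k : ℕ} (σ : Equiv.Perm (Fin k)) (μ : Measure Ω2) (θ : ℝ) : EReal :=
  ⨆ ν ∈ Mcal, (((θ * tPat σ (ν : Measure Ω2) : ℝ) : EReal) - ((KL (↑ν) μ : ℝ≥0∞) : EReal))

/-- `ℱ(σ,μ,θ)`: the set of maximizers of `ν ↦ θ t_σ(ν) − D(ν|μ)` over `ℳ`. -/
def Fset {k : ℕ} (σ : Equiv.Perm (Fin k)) (μ : Measure Ω2) (θ : ℝ) :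
    Set (ProbabilityMeasure Ω2) :=
  {ν | ν ∈ Mcal ∧
    (((θ * tPat σ (ν : Measure Ω2) : ℝ) : EReal) - ((KL (↑ν) μ : ℝ≥0∞) : EReal)) = Fsup σ μ θ}

/-- `G(σ,μ,δ) = inf { D(ν|μ) : ν ∈ ℳ, t_σ(ν) ≥ δ }`. -/
def Gfun {k : ℕ} (σ : Equiv.Perm (Fin k)) (μ : Measure Ω2) (δ : ℝ) : ℝ≥0∞ :=
  ⨅ ν ∈ {ν : ProbabilityMeasure Ω2 | ν ∈ Mcal ∧ δ ≤ tPat σ (ν : Measure Ω2)}, KL (↑ν) μ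

/-- `𝒢(σ,μ,δ)`: the set of minimizers in the definition of `G(σ,μ,δ)`. -/
def Gset {k : ℕ} (σ : Equiv.Perm (Fin k)) (μ : Measure Ω2) (δ : ℝ) :
    Set (ProbabilityMeasure Ω2) :=
  {ν | (ν ∈ Mcal ∧ δ ≤ tPat σ (ν : Measure Ω2)) ∧ KL (↑ν) μ = Gfun σ μ δ}

/-- `α_σ(μ) = inf {δ : G(σ,μ,δ) = ∞}`. -/
def alphaSig {k : ℕ} (σ : Equiv.Perm (Fin k)) (μ : Measure Ω2) : ℝ :=
  sInf {δ : ℝ | Gfun σ μ δ = ∞}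

/-- `μ` is conditionally constant (CC) with respect to a pattern `σ` of size `k+1`:
the conditional probability `P(π_{X,Y} = σ | (X₁,Y₁))`, which for i.i.d. samples equals
`z ↦ ∫ h_σ(z, w) dμ^{⊗k}(w)`, is `μ`-a.s. equal to a constant `c ∈ [0,1]`. -/
def IsCC {k : ℕ} (σ : Equiv.Perm (Fin (k + 1))) (μ : Measure Ω2) : Prop :=
  ∃ c ∈ Set.Icc (0 : ℝ) 1, ∀ᵐ z ∂μ,
    (∫ w : Fin k → Ω2, hPat σ (Fin.cons z w) ∂pmeas μ k) = c

/-- The inversion pattern `21 ∈ S₂`. -/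
def inv2 : Equiv.Perm (Fin 2) := Equiv.swap 0 1

/-- Lévy–Prokhorov (extended) distance between measures on `ℝ²`. -/
def dLPE (μ ν : Measure Ω2) : ℝ≥0∞ := levyProkhorovEDist μ ν

/-- The topological support of a measure: the points whose every open neighbourhood
has positive measure. -/
def msupport (μ : Measure Ω2) : Set Ω2 :=
  {z | ∀ U : Set Ω2, IsOpen U → z ∈ U → 0 < μ U}


open scoped Classical in
/-- The rate function `I_{σ,μ,θ}` for Gibbs random permutations. -/
def Igibbs {k : ℕ} (σ : Equiv.Perm (Fin k)) (μ : Measure Ω2) (θ : ℝ)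
    (γ : ProbabilityMeasure Ω2) : EReal :=
  if γ ∈ Mtilde then
    (⨅ ν ∈ {ν : ProbabilityMeasure Ω2 | ν ∈ Mcal ∧ Omap ↑ν = (γ : Measure Ω2)},
        (((KL (↑ν) μ : ℝ≥0∞) : EReal) - ((θ * tPat σ (ν : Measure Ω2) : ℝ) : EReal))) -
      ⨅ ν ∈ Mcal,
        (((KL ((ν : ProbabilityMeasure Ω2) : Measure Ω2) μ : ℝ≥0∞) : EReal) -
          ((θ * tPat σ ((ν : ProbabilityMeasure Ω2) : Measure Ω2) : ℝ) : EReal))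
  else ⊤

open InformationTheory in
theorem KL_eq_klDiv (ν μ : Measure Ω2) [IsFiniteMeasure ν] [IsFiniteMeasure μ] :
    KL ν μ = klDiv ν μ := by
  rw [klDiv_eq_lintegral_klFun, KL]
  rfl

open InformationTheory in
theorem ofReal_integral_le_KL (ν μ : Measure Ω2) [IsProbabilityMeasure ν]
    [IsProbabilityMeasure μ] (f : BoundedContinuousFunction Ω2 ℝ)
    (hf : ∫ x, Real.exp (f x) ∂μ ≤ 1) : ENNReal.ofReal (∫ x, f x ∂ν) ≤ KL ν μ := by
  rw [KL_eq_klDiv]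
  by_cases h : klDiv ν μ = ∞
  · simp [h]
  obtain ⟨hac, hint⟩ := klDiv_ne_top_iff.1 h
  have hk := (integrable_klFun_rnDeriv_iff hac).2 hint
  apply ENNReal.ofReal_le_of_le_toReal
  rw [toReal_klDiv_eq_integral_klFun hac, ← integral_rnDeriv_smul hac]
  have hexp : Integrable (fun x => Real.exp (f x)) μ := by
    refine Integrable.of_bound (by fun_prop) (Real.exp ‖f‖) (ae_of_all _ fun x => ?_)
    rw [Real.norm_eq_abs, Real.abs_exp]
    exact Real.exp_le_exp.2 ((le_abs_self _).trans (f.norm_coe_le_norm x))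
  have hfi : Integrable (fun x => (ν.rnDeriv μ x).toReal • f x) μ := by
    rw [integrable_rnDeriv_smul_iff hac]
    exact f.integrable ν
  have hle : ∀ x, (ν.rnDeriv μ x).toReal • f x
      ≤ klFun (ν.rnDeriv μ x).toReal - 1 + Real.exp (f x) := by
    intro x
    set g := (ν.rnDeriv μ x).toReal
    have hg : 0 ≤ g := ENNReal.toReal_nonneg
    simp only [smul_eq_mul, klFun]
    rcases hg.eq_or_lt with h0 | h0
    · rw [← h0]; simp; positivity
    · have := Real.add_one_le_exp (f x - Real.log g)
      rw [Real.exp_sub, Real.exp_log h0, le_div_iff₀ h0] at this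
      linarith
  calc _ ≤ ∫ x, (klFun (ν.rnDeriv μ x).toReal - 1 + Real.exp (f x)) ∂μ :=
        integral_mono hfi ((hk.sub (integrable_const _)).add hexp) hle
    _ = ∫ x, klFun (ν.rnDeriv μ x).toReal ∂μ - 1 + ∫ x, Real.exp (f x) ∂μ := by
        rw [integral_add (f := fun x => klFun (ν.rnDeriv μ x).toReal - 1)
          (hk.sub (integrable_const _)) hexp, integral_sub hk (integrable_const _)]
        simp
    _ ≤ _ := by linarith

theorem integrable_of_abs_le {α : Type*} [MeasurableSpace α] {μ : Measure α} [IsFiniteMeasure μ]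
    {f : α → ℝ} (hf : Measurable f) {M : ℝ} (hM : ∀ x, |f x| ≤ M) : Integrable f μ :=
  Integrable.of_bound hf.aestronglyMeasurable M (ae_of_all _ hM)

theorem integrable_exp_of_abs_le {α : Type*} [MeasurableSpace α] {μ : Measure α}
    [IsFiniteMeasure μ] {f : α → ℝ} (hf : Measurable f) {M : ℝ} (hM : ∀ x, |f x| ≤ M) :
    Integrable (fun x => Real.exp (f x)) μ :=
  integrable_of_abs_le (M := Real.exp M) (by fun_prop) fun x => by
    rw [Real.abs_exp]
    exact Real.exp_le_exp.2 ((le_abs_self _).trans (hM x))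

/-- A dual bound over bounded continuous functions extends to bounded measurable functions. -/
theorem dual_bound_of_measurable (ν μ : Measure Ω2) [IsProbabilityMeasure ν]
    [IsProbabilityMeasure μ] {b : ℝ}
    (h : ∀ f : BoundedContinuousFunction Ω2 ℝ,
      ∫ x, f x ∂ν - ∫ x, Real.exp (f x) ∂μ + 1 ≤ b)
    {f : Ω2 → ℝ} (hf : Measurable f) {M : ℝ} (hM : ∀ x, |f x| ≤ M) :
    ∫ x, f x ∂ν - ∫ x, Real.exp (f x) ∂μ + 1 ≤ b := by
  have hM0 : 0 ≤ M := (abs_nonneg _).trans (hM 0)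
  refine le_of_forall_pos_le_add fun ε hε => ?_
  set δ := ε / (1 + Real.exp M) with hδ
  have hδ0 : 0 < δ := by positivity
  obtain ⟨φ, hφ, hφi⟩ := (integrable_of_abs_le (μ := μ + ν) hf hM).exists_boundedContinuous_integral_sub_le
    hδ0
  let φ' : BoundedContinuousFunction Ω2 ℝ :=
    BoundedContinuousFunction.ofNormedAddCommGroup (fun x => max (-M) (min M (φ x)))
      (by fun_prop) M (fun x => by
        rw [Real.norm_eq_abs, abs_le]
        exact ⟨le_max_left _ _, max_le (by linarith) (min_le_left _ _)⟩)
  have hφ'M : ∀ x, |φ' x| ≤ M := fun x => by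
    change |max (-M) (min M (φ x))| ≤ M
    rw [abs_le]
    exact ⟨le_max_left _ _, max_le (by linarith) (min_le_left _ _)⟩
  have hclose : ∀ x, |f x - φ' x| ≤ ‖f x - φ x‖ := fun x => by
    change |f x - max (-M) (min M (φ x))| ≤ |f x - φ x|
    have := abs_le.1 (hM x)
    rw [abs_le]
    constructor <;> rcases max_cases (-M) (min M (φ x)) with h | h <;>
      rcases min_cases M (φ x) with h' | h' <;> rcases abs_cases (f x - φ x) with h'' | h'' <;>
      linarith
  have hφm : Measurable φ' := φ'.continuous.measurable
  have hdi : ∀ (κ : Measure Ω2) [IsFiniteMeasure κ], Integrable (fun x => |f x - φ' x|) κ :=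
    fun κ _ => integrable_of_abs_le (M := M + M) (by fun_prop) fun x => by
      rw [abs_abs]
      exact (abs_sub _ _).trans (add_le_add (hM x) (hφ'M x))
  have hsum : ∫ x, |f x - φ' x| ∂μ + ∫ x, |f x - φ' x| ∂ν ≤ δ := by
    rw [← integral_add_measure (hdi μ) (hdi ν)]
    exact (integral_mono (hdi _) ((integrable_of_abs_le hf hM).sub hφi).norm hclose).trans hφ
  have h1 : 0 ≤ ∫ x, |f x - φ' x| ∂μ := integral_nonneg fun _ => abs_nonneg _
  have h2 : 0 ≤ ∫ x, |f x - φ' x| ∂ν := integral_nonneg fun _ => abs_nonneg _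
  have hA : ∫ x, f x ∂ν ≤ ∫ x, φ' x ∂ν + ∫ x, |f x - φ' x| ∂ν := by
    rw [← integral_add (φ'.integrable ν) (hdi ν)]
    refine integral_mono (integrable_of_abs_le hf hM) ((φ'.integrable ν).add (hdi ν)) fun x => ?_
    have := le_abs_self (f x - φ' x)
    dsimp only [Pi.add_apply]
    linarith
  have hB : ∫ x, Real.exp (φ' x) ∂μ
      ≤ ∫ x, Real.exp (f x) ∂μ + Real.exp M * ∫ x, |f x - φ' x| ∂μ := by
    rw [← integral_const_mul, ← integral_add (integrable_exp_of_abs_le hf hM)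
      ((hdi μ).const_mul _)]
    refine integral_mono (integrable_exp_of_abs_le hφm hφ'M)
      ((integrable_exp_of_abs_le hf hM).add ((hdi μ).const_mul _)) fun x => ?_
    dsimp only [Pi.add_apply]
    have h3 := Real.add_one_le_exp (f x - φ' x)
    have h4 : Real.exp (f x) = Real.exp (φ' x) * Real.exp (f x - φ' x) := by
      rw [← Real.exp_add]; ring_nf
    have h5 : Real.exp (φ' x) ≤ Real.exp M :=
      Real.exp_le_exp.2 ((le_abs_self _).trans (hφ'M x))
    have h6 := Real.exp_pos (φ' x)
    have h7 := neg_abs_le (f x - φ' x)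
    have h8 := abs_nonneg (f x - φ' x)
    nlinarith
  have hC := h φ'
  have hD : Real.exp M * ∫ x, |f x - φ' x| ∂μ ≤ Real.exp M * δ := by
    gcongr; linarith
  have hE : δ + Real.exp M * δ = ε := by
    rw [hδ]; field_simp
  linarith

open InformationTheory in
theorem KL_le_of_dual_bound (ν μ : Measure Ω2) [IsProbabilityMeasure ν]
    [IsProbabilityMeasure μ] {b : ℝ}
    (h : ∀ f : BoundedContinuousFunction Ω2 ℝ,
      ∫ x, f x ∂ν - ∫ x, Real.exp (f x) ∂μ + 1 ≤ b) : KL ν μ ≤ ENNReal.ofReal b := by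
  have hac : ν ≪ μ := by
    refine Measure.AbsolutelyContinuous.mk fun N hN hμN => ?_
    by_contra hne
    have hpos : 0 < ν.real N := by
      rw [measureReal_def]; exact ENNReal.toReal_pos hne (measure_ne_top _ _)
    obtain ⟨m, hm⟩ := exists_nat_gt (b / ν.real N)
    have hb := dual_bound_of_measurable ν μ h (f := N.indicator fun _ => (m : ℝ))
      (by fun_prop (disch := assumption)) (M := m) (fun x => by
        by_cases hx : x ∈ N <;> simp [hx])
    have h1 : ∫ x, Real.exp (N.indicator (fun _ => (m : ℝ)) x) ∂μ = 1 := by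
      rw [integral_congr_ae (g := fun _ => (1 : ℝ))]
      · simp
      · filter_upwards [measure_eq_zero_iff_ae_notMem.1 hμN] with x hx
        simp [hx]
    rw [h1, integral_indicator hN, setIntegral_const, smul_eq_mul] at hb
    rw [div_lt_iff₀ hpos] at hm
    linarith
  rw [KL, if_pos hac]
  set g : Ω2 → ℝ := fun x => (ν.rnDeriv μ x).toReal with hg
  have hgm : Measurable g := by fun_prop
  have hg0 : ∀ x, 0 ≤ g x := fun x => ENNReal.toReal_nonneg
  let c : ℕ → ℝ → ℝ := fun n y => max (Real.exp (-n)) (min (Real.exp n) y)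
  have hc0 : ∀ n y, 0 < c n y := fun n y => lt_max_of_lt_left (Real.exp_pos _)
  have hcm : ∀ n, Measurable (c n) := fun n => by fun_prop
  let ψ : ℕ → ℝ → ℝ := fun n y => y * Real.log (c n y) - c n y + 1
  have hψ0 : ∀ n y, 0 ≤ y → 0 ≤ ψ n y := by
    intro n y hy
    have h1 : 0 ≤ c n y * Real.log (c n y) - c n y + 1 := by
      have := InformationTheory.klFun_nonneg (hc0 n y).le
      rw [klFun] at this; linarith
    have h2 : 0 ≤ (y - c n y) * Real.log (c n y) := by
      have hn0 : (0 : ℝ) ≤ n := n.cast_nonneg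
      have hn : Real.exp (-n) ≤ 1 := Real.exp_le_one_iff.2 (by linarith)
      have hn' : 1 ≤ Real.exp n := Real.one_le_exp hn0
      rcases le_total 1 (c n y) with h | h
      · rcases h.eq_or_lt with h' | h'
        · rw [← h']; simp
        refine mul_nonneg ?_ (Real.log_nonneg h)
        simp only [c] at h' ⊢
        rcases lt_max_iff.1 h' with h | h
        · linarith
        · rw [sub_nonneg]
          exact max_le ((hn.trans h.le).trans (min_le_right _ _)) (min_le_right _ _)
      · rcases h.eq_or_lt with h' | h'
        · rw [h']; simp
        refine mul_nonneg_of_nonpos_of_nonpos ?_ (Real.log_nonpos (hc0 n y).le h)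
        simp only [c] at h' ⊢
        have := (max_lt_iff.1 h').2
        rcases min_lt_iff.1 this with h3 | h3
        · linarith
        · rw [min_eq_right (by linarith)]
          linarith [le_max_right (Real.exp (-n)) y]
    simp only [ψ]; linarith
  have hlim : ∀ y, 0 ≤ y → Tendsto (fun n => ψ n y) atTop (𝓝 (y * Real.log y + 1 - y)) := by
    intro y hy
    have hexp : Tendsto (fun n : ℕ => Real.exp (-(n : ℝ))) atTop (𝓝 0) :=
      Real.tendsto_exp_neg_atTop_nhds_zero.comp tendsto_natCast_atTop_atTop
    have hexp' : Tendsto (fun n : ℕ => Real.exp (n : ℝ)) atTop atTop :=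
      Real.tendsto_exp_atTop.comp tendsto_natCast_atTop_atTop
    rcases hy.eq_or_lt with rfl | hy
    · have : (fun n => ψ n 0) = fun n : ℕ => - Real.exp (-(n : ℝ)) + 1 := by
        ext n
        simp only [ψ, c, min_eq_right (Real.exp_pos (n : ℝ)).le,
          max_eq_left (Real.exp_pos (-(n : ℝ))).le]
        ring
      rw [this]
      simpa using hexp.neg.add_const 1
    · refine tendsto_const_nhds.congr' ?_
      filter_upwards [hexp.eventually_lt_const hy, hexp'.eventually_ge_atTop y] with n h1 h2
      simp only [ψ, c, min_eq_right h2, max_eq_right h1.le]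
      ring
  have hint : ∀ n, ∫⁻ x, ENNReal.ofReal (ψ n (g x)) ∂μ ≤ ENNReal.ofReal b := by
    intro n
    have hMb : ∀ x, |Real.log (c n (g x))| ≤ n := fun x => by
      rw [abs_le]
      constructor
      · rw [Real.le_log_iff_exp_le (hc0 _ _)]
        exact le_max_left _ _
      · rw [Real.log_le_iff_le_exp (hc0 _ _)]
        exact max_le (Real.exp_le_exp.2 (by linarith [n.cast_nonneg (α := ℝ)])) (min_le_left _ _)
    have hm : Measurable fun x => Real.log (c n (g x)) :=
      Real.measurable_log.comp ((hcm n).comp hgm)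
    have hb := dual_bound_of_measurable ν μ h hm hMb
    have i1 : Integrable (fun x => g x * Real.log (c n (g x))) μ := by
      have := (integrable_rnDeriv_smul_iff (μ := ν) (ν := μ) hac
        (f := fun x => Real.log (c n (g x)))).2 (integrable_of_abs_le hm hMb)
      simpa [smul_eq_mul] using this
    have i2 := integrable_exp_of_abs_le (μ := μ) hm hMb
    simp only [Real.exp_log (hc0 _ _)] at i2 hb
    rw [← integral_rnDeriv_smul hac] at hb
    rw [← ofReal_integral_eq_lintegral_ofReal (f := fun x => ψ n (g x))
      ((i1.sub i2).add (integrable_const _)) (ae_of_all _ fun x => hψ0 n _ (hg0 x))]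
    apply ENNReal.ofReal_le_ofReal
    refine le_trans (le_of_eq ?_) hb
    simp only [smul_eq_mul]
    change ∫ x, (g x * Real.log (c n (g x)) - c n (g x)) + 1 ∂μ = _
    rw [integral_add (f := fun x => g x * Real.log (c n (g x)) - c n (g x)) (i1.sub i2) (integrable_const _), integral_sub i1 i2]
    simp [hg]
  calc ∫⁻ x, ENNReal.ofReal (g x * Real.log (g x) + 1 - g x) ∂μ
      = ∫⁻ x, liminf (fun n => ENNReal.ofReal (ψ n (g x))) atTop ∂μ := by
        congr 1; ext x
        exact ((ENNReal.continuous_ofReal.tendsto _).comp (hlim _ (hg0 x))).liminf_eq.symm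
    _ ≤ liminf (fun n => ∫⁻ x, ENNReal.ofReal (ψ n (g x)) ∂μ) atTop :=
        lintegral_liminf_le fun n => by
          have := (hcm n).comp hgm
          have := (hgm.mul (Real.measurable_log.comp this)).sub this |>.add_const 1
          exact this.ennreal_ofReal
    _ ≤ ENNReal.ofReal b := by
        refine (liminf_le_liminf (Eventually.of_forall hint)).trans ?_
        simp

theorem exists_dual_of_lt_KL (ν μ : Measure Ω2) [IsProbabilityMeasure ν]
    [IsProbabilityMeasure μ] {b : ℝ} (h : ENNReal.ofReal b < KL ν μ) :
    ∃ f : BoundedContinuousFunction Ω2 ℝ, ∫ x, Real.exp (f x) ∂μ ≤ 1 ∧ b < ∫ x, f x ∂ν := by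
  by_contra! hcon
  refine h.not_ge (KL_le_of_dual_bound ν μ fun f => ?_)
  have hi := integrable_exp_of_abs_le (μ := μ) f.continuous.measurable f.norm_coe_le_norm
  have hpos : 0 < ∫ x, Real.exp (f x) ∂μ := integral_exp_pos hi
  set c := Real.log (∫ x, Real.exp (f x) ∂μ)
  have h1 := hcon (f - BoundedContinuousFunction.const _ c) (by
    simp only [BoundedContinuousFunction.coe_sub, Pi.sub_apply,
      BoundedContinuousFunction.const_apply, Real.exp_sub, integral_div]
    rw [Real.exp_log hpos, div_self hpos.ne'])
  simp only [BoundedContinuousFunction.coe_sub, Pi.sub_apply,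
      BoundedContinuousFunction.const_apply] at h1
  rw [integral_sub (f.integrable ν) (integrable_const _)] at h1
  simp at h1
  have := Real.log_le_sub_one_of_pos hpos
  linarith

theorem isCompact_Pcal : IsCompact Pcal := by
  have h := isCompact_setOfPred_probabilityMeasure_mass_eq_compl_isCompact_le (E := Ω2)
    (u := fun _ => 0) (K := fun _ => unitSq) tendsto_const_nhds
    (fun _ => isCompact_Icc.prod isCompact_Icc) (Or.inl inferInstance)
  convert h using 1
  ext μ
  have hm : MeasurableSet unitSq := measurableSet_Icc.prod measurableSet_Icc
  simp only [Pcal, Set.mem_ofPred_eq, nonpos_iff_eq_zero, forall_const]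
  rw [← prob_compl_eq_zero_iff hm, ← ProbabilityMeasure.ennreal_coeFn_eq_coeFn_toMeasure]
  simp

theorem measurableSet_unitSq : MeasurableSet unitSq := measurableSet_Icc.prod measurableSet_Icc

theorem ae_mem_unitSq {ρ : ProbabilityMeasure Ω2} (h : ρ ∈ Pcal) :
    ∀ᵐ p ∂(ρ : Measure Ω2), p ∈ unitSq := by
  exact (mem_ae_iff_prob_eq_one measurableSet_unitSq).2 h

theorem monotone_cdfX (μ : Measure Ω2) [IsFiniteMeasure μ] : Monotone (cdfX μ) := fun _ _ h =>
  measureReal_mono fun _ hp => le_trans hp h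

theorem monotone_cdfY (μ : Measure Ω2) [IsFiniteMeasure μ] : Monotone (cdfY μ) := fun _ _ h =>
  measureReal_mono fun _ hp => le_trans hp h

theorem cdfX_mem_Icc (μ : Measure Ω2) [IsProbabilityMeasure μ] (x : ℝ) :
    cdfX μ x ∈ Set.Icc (0 : ℝ) 1 := ⟨measureReal_nonneg, measureReal_le_one⟩

theorem cdfY_mem_Icc (μ : Measure Ω2) [IsProbabilityMeasure μ] (x : ℝ) :
    cdfY μ x ∈ Set.Icc (0 : ℝ) 1 := ⟨measureReal_nonneg, measureReal_le_one⟩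

/-- The map `(x, y) ↦ (F₁ x, F₂ y)` built from the marginal CDFs. -/
def cdfMap (μ : Measure Ω2) (p : Ω2) : Ω2 := (cdfX μ p.1, cdfY μ p.2)

theorem measurable_cdfMap (μ : Measure Ω2) [IsFiniteMeasure μ] : Measurable (cdfMap μ) :=
  ((monotone_cdfX μ).measurable.comp measurable_fst).prodMk
    ((monotone_cdfY μ).measurable.comp measurable_snd)

/-- The map `𝒪` on probability measures. -/
def OmapP (ρ : ProbabilityMeasure Ω2) : ProbabilityMeasure Ω2 :=
  ⟨Omap ρ, Measure.isProbabilityMeasure_map (measurable_cdfMap _).aemeasurable⟩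

theorem continuous_cdf_of_atomless (m : Measure ℝ) [IsProbabilityMeasure m]
    (h : ∀ x, m {x} = 0) : Continuous (ProbabilityTheory.cdf m) := by
  rw [continuous_iff_continuousAt]
  intro x
  have h1 := h x
  rw [← ProbabilityTheory.measure_cdf m, StieltjesFunction.measure_singleton,
    ENNReal.ofReal_eq_zero] at h1
  have hmono := ProbabilityTheory.monotone_cdf m
  rw [hmono.continuousAt_iff_leftLim_eq_rightLim, StieltjesFunction.rightLim_eq]
  exact le_antisymm (hmono.leftLim_le le_rfl) (by linarith)

/-- The probability integral transform. -/
theorem map_cdf_eq_unif01 (m : Measure ℝ) [IsProbabilityMeasure m]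
    (h : ∀ x, m {x} = 0) : m.map (ProbabilityTheory.cdf m) = unif01 := by
  set F := ProbabilityTheory.cdf m
  have hF : Continuous F := continuous_cdf_of_atomless m h
  have hmF : Measurable F := hF.measurable
  have hFm : ∀ x, m (Set.Iic x) = ENNReal.ofReal (F x) := fun x =>
    (ProbabilityTheory.ofReal_cdf m x).symm
  have := Measure.isProbabilityMeasure_map (μ := m) hmF.aemeasurable
  have hivt : ∀ a, 0 < a → a < 1 → ∃ x, F x = a := by
    intro a h0 h1
    obtain ⟨x, hx⟩ := ((ProbabilityTheory.tendsto_cdf_atBot m).eventually_lt_const h0).exists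
    obtain ⟨y, hy⟩ := ((ProbabilityTheory.tendsto_cdf_atTop m).eventually_const_lt h1).exists
    exact mem_range_of_exists_le_of_exists_ge hF ⟨x, hx.le⟩ ⟨y, hy.le⟩
  have hu : ∀ a, unif01 (Set.Iic a) = ENNReal.ofReal (min a 1) := by
    intro a
    rw [unif01, Measure.restrict_apply measurableSet_Iic]
    have : Set.Iic a ∩ Set.Icc 0 1 = Set.Icc 0 (min a 1) := by
      ext x; simp only [Set.mem_inter_iff, Set.mem_Iic, Set.mem_Icc, le_min_iff]; tauto
    simp [this]
  have hfin : IsFiniteMeasure unif01 := by unfold unif01; infer_instance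
  refine Measure.ext_of_Iic _ _ fun a => ?_
  rw [hu, Measure.map_apply hmF measurableSet_Iic]
  rcases le_or_gt 1 a with h1 | h1
  · have : F ⁻¹' Set.Iic a = Set.univ := by
      ext x; simp only [Set.mem_preimage, Set.mem_Iic, Set.mem_univ, iff_true]
      exact (ProbabilityTheory.cdf_le_one m x).trans h1
    rw [this, min_eq_right h1]; simp
  rw [min_eq_left h1.le]
  rcases lt_or_ge a 0 with h0 | h0
  · have : F ⁻¹' Set.Iic a = ∅ := by
      ext x; simp only [Set.mem_preimage, Set.mem_Iic, Set.mem_empty_iff_false, iff_false, not_le]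
      exact h0.trans_le (ProbabilityTheory.cdf_nonneg m x)
    rw [this, ENNReal.ofReal_of_nonpos h0.le]; simp
  apply le_antisymm
  · have hr : m.real (F ⁻¹' Set.Iic a) ≤ a := by
      refine le_of_forall_gt_imp_ge_of_dense fun c hc => ?_
      rcases le_or_gt 1 c with h2 | h2
      · exact measureReal_le_one.trans h2
      obtain ⟨x, rfl⟩ := hivt c (h0.trans_lt hc) h2
      rw [← ENNReal.ofReal_le_ofReal_iff (ProbabilityTheory.cdf_nonneg m x), ofReal_measureReal,
        ← hFm]
      refine measure_mono fun y hy => ?_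
      by_contra hxy
      exact absurd (ProbabilityTheory.monotone_cdf m (not_le.1 hxy).le) (not_le.2 (lt_of_le_of_lt hy hc))
    rw [← ofReal_measureReal]
    exact ENNReal.ofReal_le_ofReal hr
  · rcases h0.eq_or_lt with rfl | h0
    · simp
    obtain ⟨x, rfl⟩ := hivt a h0 h1
    rw [← hFm]
    exact measure_mono fun y hy => ProbabilityTheory.monotone_cdf m hy

theorem cdfX_eq_cdf (μ : Measure Ω2) [IsProbabilityMeasure μ] :
    cdfX μ = ProbabilityTheory.cdf (μ.map Prod.fst) := by
  have := Measure.isProbabilityMeasure_map (μ := μ) measurable_fst.aemeasurable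
  ext x
  rw [ProbabilityTheory.cdf_eq_real, measureReal_def, Measure.map_apply measurable_fst
    measurableSet_Iic]
  rfl

theorem cdfY_eq_cdf (μ : Measure Ω2) [IsProbabilityMeasure μ] :
    cdfY μ = ProbabilityTheory.cdf (μ.map Prod.snd) := by
  have := Measure.isProbabilityMeasure_map (μ := μ) measurable_snd.aemeasurable
  ext x
  rw [ProbabilityTheory.cdf_eq_real, measureReal_def, Measure.map_apply measurable_snd
    measurableSet_Iic]
  rfl

theorem continuous_cdfX {ν : ProbabilityMeasure Ω2} (h : ν ∈ Mcal) : Continuous (cdfX ν) := by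
  have := Measure.isProbabilityMeasure_map (μ := (ν : Measure Ω2)) measurable_fst.aemeasurable
  rw [cdfX_eq_cdf]
  exact continuous_cdf_of_atomless _ h.2.1

theorem continuous_cdfY {ν : ProbabilityMeasure Ω2} (h : ν ∈ Mcal) : Continuous (cdfY ν) := by
  have := Measure.isProbabilityMeasure_map (μ := (ν : Measure Ω2)) measurable_snd.aemeasurable
  rw [cdfY_eq_cdf]
  exact continuous_cdf_of_atomless _ h.2.2

theorem OmapP_mem_Mtilde {ν : ProbabilityMeasure Ω2} (h : ν ∈ Mcal) : OmapP ν ∈ Mtilde := by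
  have h1 := Measure.isProbabilityMeasure_map (μ := (ν : Measure Ω2)) measurable_fst.aemeasurable
  have h2 := Measure.isProbabilityMeasure_map (μ := (ν : Measure Ω2)) measurable_snd.aemeasurable
  have hO : ((OmapP ν : ProbabilityMeasure Ω2) : Measure Ω2) = Measure.map (cdfMap ν) ν := rfl
  refine ⟨?_, ?_, ?_⟩
  · change ((OmapP ν : ProbabilityMeasure Ω2) : Measure Ω2) unitSq = 1
    rw [hO, Measure.map_apply (measurable_cdfMap _) measurableSet_unitSq]
    have : cdfMap (ν : Measure Ω2) ⁻¹' unitSq = Set.univ :=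
      Set.eq_univ_of_forall fun p => ⟨cdfX_mem_Icc _ _, cdfY_mem_Icc _ _⟩
    simp [this]
  · rw [hO, Measure.map_map measurable_fst (measurable_cdfMap _), ← map_cdf_eq_unif01 _ h.2.1,
      Measure.map_map (ProbabilityTheory.monotone_cdf _).measurable measurable_fst,
      ← cdfX_eq_cdf]
    rfl
  · rw [hO, Measure.map_map measurable_snd (measurable_cdfMap _), ← map_cdf_eq_unif01 _ h.2.2,
      Measure.map_map (ProbabilityTheory.monotone_cdf _).measurable measurable_snd,
      ← cdfY_eq_cdf]
    rfl

/-- Pointwise convergence of monotone functions to a continuous limit is locally uniform. -/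
theorem tendstoLocallyUniformly_of_monotone {ι : Type*} {l : Filter ι} {F : ι → ℝ → ℝ}
    {G : ℝ → ℝ} (hF : ∀ i, Monotone (F i)) (hG : Continuous G)
    (h : ∀ x, Tendsto (fun i => F i x) l (𝓝 (G x))) : TendstoLocallyUniformly F G l := by
  rw [Metric.tendstoLocallyUniformly_iff]
  intro ε hε x
  have hGx : ∀ᶠ y in 𝓝 x, |G y - G x| < ε / 4 := by
    have := (hG.tendsto x).eventually (Metric.ball_mem_nhds (G x) (ε := ε / 4) (by positivity))
    simpa [Metric.mem_ball, Real.dist_eq] using this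
  obtain ⟨δ, hδ, hball⟩ := Metric.eventually_nhds_iff.1 hGx
  have hu := hball (y := x - δ / 2) (by simp [abs_of_pos, hδ])
  have hv := hball (y := x + δ / 2) (by simp [abs_of_pos, hδ])
  refine ⟨Set.Icc (x - δ / 2) (x + δ / 2), Icc_mem_nhds (by linarith) (by linarith), ?_⟩
  have key : ∀ z, ∀ᶠ i in l, |F i z - G z| < ε / 4 := fun z => by
    have := (h z).eventually (Metric.ball_mem_nhds (G z) (ε := ε / 4) (by positivity))
    simpa [Metric.mem_ball, Real.dist_eq] using this
  filter_upwards [key (x - δ / 2), key (x + δ / 2)] with i h1 h2 y hy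
  have h3 := hF i hy.1
  have h4 := hF i hy.2
  have h5 := hball (y := y) (by
    rw [Real.dist_eq, abs_lt]; constructor <;> linarith [hy.1, hy.2])
  rw [Real.dist_eq, abs_lt]
  rw [abs_lt] at *
  constructor <;> linarith

theorem tendsto_toReal_measure_of_null_frontier {α : Type*} [MeasurableSpace α]
    [TopologicalSpace α] [OpensMeasurableSpace α] [HasOuterApproxClosed α]
    {ν : ProbabilityMeasure α} {s : Set α} (h : (ν : Measure α) (frontier s) = 0) :
    Tendsto (fun ρ : ProbabilityMeasure α => ((ρ : Measure α) s).toReal) (𝓝 ν)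
      (𝓝 ((ν : Measure α) s).toReal) :=
  (ENNReal.tendsto_toReal (measure_ne_top _ _)).comp
    (ProbabilityMeasure.tendsto_measure_of_null_frontier_of_tendsto' tendsto_id h)

theorem tendsto_cdfX {ν : ProbabilityMeasure Ω2} (h : ν ∈ Mcal) (x : ℝ) :
    Tendsto (fun ρ : ProbabilityMeasure Ω2 => cdfX ρ x) (𝓝 ν) (𝓝 (cdfX ν x)) := by
  apply tendsto_toReal_measure_of_null_frontier
  refine measure_mono_null (frontier_le_subset_eq continuous_fst continuous_const) ?_
  have := h.2.1 x
  rwa [Measure.map_apply measurable_fst (measurableSet_singleton _)] at this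

theorem tendsto_cdfY {ν : ProbabilityMeasure Ω2} (h : ν ∈ Mcal) (x : ℝ) :
    Tendsto (fun ρ : ProbabilityMeasure Ω2 => cdfY ρ x) (𝓝 ν) (𝓝 (cdfY ν x)) := by
  apply tendsto_toReal_measure_of_null_frontier
  refine measure_mono_null (frontier_le_subset_eq continuous_snd continuous_const) ?_
  have := h.2.2 x
  rwa [Measure.map_apply measurable_snd (measurableSet_singleton _)] at this

theorem tendstoUniformlyOn_cdfMap {ν : ProbabilityMeasure Ω2} (h : ν ∈ Mcal) :
    TendstoUniformlyOn (fun ρ : ProbabilityMeasure Ω2 => cdfMap ρ) (cdfMap ν) (𝓝 ν) unitSq := by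
  have hX := (tendstoLocallyUniformlyOn_iff_tendstoUniformlyOn_of_compact
    (isCompact_Icc (a := (0 : ℝ)) (b := 1))).1 (tendstoLocallyUniformly_of_monotone
      (F := fun ρ : ProbabilityMeasure Ω2 => cdfX ρ) (fun ρ => monotone_cdfX _)
      (continuous_cdfX h) (tendsto_cdfX h)).tendstoLocallyUniformlyOn
  have hY := (tendstoLocallyUniformlyOn_iff_tendstoUniformlyOn_of_compact
    (isCompact_Icc (a := (0 : ℝ)) (b := 1))).1 (tendstoLocallyUniformly_of_monotone
      (F := fun ρ : ProbabilityMeasure Ω2 => cdfY ρ) (fun ρ => monotone_cdfY _)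
      (continuous_cdfY h) (tendsto_cdfY h)).tendstoLocallyUniformlyOn
  rw [Metric.tendstoUniformlyOn_iff] at *
  intro ε hε
  filter_upwards [hX ε hε, hY ε hε] with ρ h1 h2 p hp
  rw [Prod.dist_eq]
  exact max_lt (h1 _ hp.1) (h2 _ hp.2)

theorem continuousWithinAt_OmapP {ν : ProbabilityMeasure Ω2} (h : ν ∈ Mcal) :
    ContinuousWithinAt OmapP Pcal ν := by
  rw [ContinuousWithinAt, ProbabilityMeasure.tendsto_iff_forall_integral_tendsto]
  intro f
  have hO : ∀ ρ : ProbabilityMeasure Ω2, ∫ p, f p ∂((OmapP ρ : ProbabilityMeasure Ω2) : Measure Ω2)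
      = ∫ p, f (cdfMap ρ p) ∂(ρ : Measure Ω2) := fun ρ =>
    integral_map (measurable_cdfMap _).aemeasurable f.continuous.aestronglyMeasurable
  simp_rw [hO]
  have hcont : Continuous (cdfMap (ν : Measure Ω2)) :=
    ((continuous_cdfX h).comp continuous_fst).prodMk ((continuous_cdfY h).comp continuous_snd)
  let φ : BoundedContinuousFunction Ω2 ℝ := f.compContinuous ⟨_, hcont⟩
  have hφ := ((ProbabilityMeasure.tendsto_iff_forall_integral_tendsto.1
    (tendsto_id (α := ProbabilityMeasure Ω2) (x := 𝓝 ν))) φ).mono_left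
    (nhdsWithin_le_nhds (s := Pcal))
  have hmem : ∀ (ρ : ProbabilityMeasure Ω2) p, cdfMap (ρ : Measure Ω2) p ∈ unitSq := fun ρ p =>
    ⟨cdfX_mem_Icc _ _, cdfY_mem_Icc _ _⟩
  have huc : UniformContinuousOn f unitSq :=
    (isCompact_Icc.prod isCompact_Icc).uniformContinuousOn_of_continuous f.continuous.continuousOn
  have hdiff : Tendsto (fun ρ : ProbabilityMeasure Ω2 =>
      ∫ p, f (cdfMap ρ p) ∂(ρ : Measure Ω2) - ∫ p, φ p ∂(ρ : Measure Ω2)) (𝓝[Pcal] ν) (𝓝 0) := by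
    rw [Metric.tendsto_nhds]
    intro ε hε
    obtain ⟨δ, hδ, hfδ⟩ := Metric.uniformContinuousOn_iff.1 huc (ε / 2) (by positivity)
    filter_upwards [nhdsWithin_le_nhds ((Metric.tendstoUniformlyOn_iff.1
      (tendstoUniformlyOn_cdfMap h)) δ hδ), self_mem_nhdsWithin] with ρ hρ hP
    have i1 : Integrable (fun p => f (cdfMap ρ p)) (ρ : Measure Ω2) :=
      integrable_of_abs_le (f.continuous.measurable.comp (measurable_cdfMap _))
        (fun p => f.norm_coe_le_norm _)
    rw [← integral_sub i1 (φ.integrable _), dist_zero_right]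
    refine lt_of_le_of_lt (norm_integral_le_of_norm_le_const (C := ε / 2) ?_) ?_
    · filter_upwards [ae_mem_unitSq hP] with p hp
      have := hfδ _ (hmem ν p) _ (hmem ρ p) (hρ p hp)
      rw [dist_comm, dist_eq_norm] at this
      exact this.le
    · simp; linarith
  have hφν : ∫ p, φ p ∂(ν : Measure Ω2) = ∫ p, f (cdfMap ν p) ∂(ν : Measure Ω2) := rfl
  simpa [hφν] using hdiff.add hφ

/-- The configurations of points which induce the pattern `σ`. -/
def patSet {k : ℕ} (σ : Equiv.Perm (Fin k)) : Set (Fin k → Ω2) :=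
  {z | ∃ τ : Equiv.Perm (Fin k),
    StrictMono (fun i => (z (τ i)).1) ∧ StrictMono (fun i => (z (τ (σ⁻¹ i))).2)}

theorem hPat_eq_indicator {k : ℕ} (σ : Equiv.Perm (Fin k)) :
    hPat σ = (patSet σ).indicator fun _ => 1 := by
  ext z
  simp only [hPat, Set.indicator, patSet, Set.mem_ofPred_eq]
  congr

theorem hPat_eq_one_iff {k : ℕ} {σ : Equiv.Perm (Fin k)} {z : Fin k → Ω2} :
    hPat σ z = 1 ↔ z ∈ patSet σ := by
  rw [hPat_eq_indicator]
  by_cases h : z ∈ patSet σ <;> simp [h]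

theorem isOpen_setOf_strictMono {α : Type*} [TopologicalSpace α] {k : ℕ} {f : α → Fin k → ℝ}
    (hf : ∀ i, Continuous fun z => f z i) : IsOpen {z | StrictMono (f z)} := by
  have : {z | StrictMono (f z)} = ⋂ (i : Fin k) (j : Fin k) (_ : i < j), {z | f z i < f z j} := by
    ext z; simp [StrictMono]
  rw [this]
  exact isOpen_iInter_of_finite fun i => isOpen_iInter_of_finite fun j =>
    isOpen_iInter_of_finite fun _ => isOpen_lt (hf i) (hf j)

theorem isOpen_patSet {k : ℕ} (σ : Equiv.Perm (Fin k)) : IsOpen (patSet σ) := by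
  have : patSet σ = ⋃ τ : Equiv.Perm (Fin k), {z : Fin k → Ω2 | StrictMono fun i => (z (τ i)).1} ∩
      {z | StrictMono fun i => (z (τ (σ⁻¹ i))).2} := by
    ext z; simp [patSet]
  rw [this]
  exact isOpen_iUnion fun τ => (isOpen_setOf_strictMono fun i => by fun_prop).inter
    (isOpen_setOf_strictMono fun i => by fun_prop)

theorem card_filter_le_of_strictMono {n : ℕ} {w : Fin n → ℝ} {e : Equiv.Perm (Fin n)}
    (h : StrictMono fun i => w (e i)) (i : Fin n) :
    (Finset.univ.filter fun j => w j ≤ w (e i)).card = (i : ℕ) + 1 := by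
  rw [← Fin.card_Iic]
  symm
  refine Finset.card_bij (fun a _ => e a) (fun a ha => ?_) (fun _ _ _ _ h => e.injective h)
    fun b hb => ⟨e.symm b, ?_, by simp⟩
  · simpa using h.monotone (Finset.mem_Iic.1 ha)
  · simp only [Finset.mem_filter, Finset.mem_univ, true_and] at hb
    rw [Finset.mem_Iic, ← h.le_iff_le]
    simpa using hb

theorem perm_unique_of_strictMono {n : ℕ} {w : Fin n → ℝ} {e e' : Equiv.Perm (Fin n)}
    (h : StrictMono fun i => w (e i)) (h' : StrictMono fun i => w (e' i)) : e = e' := by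
  rw [← inv_inj]
  ext j
  have h1 := card_filter_le_of_strictMono h (e⁻¹ j)
  have h2 := card_filter_le_of_strictMono h' (e'⁻¹ j)
  have e1 : e (e⁻¹ j) = j := e.apply_symm_apply j
  have e2 : e' (e'⁻¹ j) = j := e'.apply_symm_apply j
  rw [e1] at h1
  rw [e2] at h2
  omega

theorem patSet_inj {k : ℕ} {σ σ' : Equiv.Perm (Fin k)} {z : Fin k → Ω2} (h : z ∈ patSet σ)
    (h' : z ∈ patSet σ') : σ = σ' := by
  obtain ⟨τ, h1, h2⟩ := h
  obtain ⟨τ', h1', h2'⟩ := h'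
  obtain rfl := perm_unique_of_strictMono (w := fun i => (z i).1) h1 h1'
  have := perm_unique_of_strictMono (w := fun i => (z i).2) (e := τ * σ⁻¹) (e' := τ * σ'⁻¹) h2 h2'
  simpa using this

theorem exists_mem_patSet {k : ℕ} {z : Fin k → Ω2} (h1 : Function.Injective fun i => (z i).1)
    (h2 : Function.Injective fun i => (z i).2) : ∃ σ, z ∈ patSet σ := by
  have m1 := (Tuple.monotone_sort fun i => (z i).1).strictMono_of_injective
    (h1.comp (Equiv.injective _))
  have m2 := (Tuple.monotone_sort fun i => (z i).2).strictMono_of_injective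
    (h2.comp (Equiv.injective _))
  refine ⟨(Tuple.sort fun i => (z i).2)⁻¹ * (Tuple.sort fun i => (z i).1),
    Tuple.sort fun i => (z i).1, m1, ?_⟩
  have (i : Fin k) : (Tuple.sort fun i => (z i).1)
      (((Tuple.sort fun i => (z i).2)⁻¹ * (Tuple.sort fun i => (z i).1))⁻¹ i)
      = (Tuple.sort fun i => (z i).2) i := by simp
  simp only [this]
  exact m2

theorem inducedPerm_eq {n : ℕ} {z : Fin n → Ω2} {π : Equiv.Perm (Fin n)} (h : z ∈ patSet π) :
    inducedPerm z = π := by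
  have hex : ∃ σ : Equiv.Perm (Fin n), hPat σ z = 1 := ⟨π, hPat_eq_one_iff.2 h⟩
  rw [inducedPerm, dif_pos hex]
  exact patSet_inj (hPat_eq_one_iff.1 hex.choose_spec) h

theorem measurableSet_inducedPerm {n : ℕ} (S : Set (Equiv.Perm (Fin n))) :
    MeasurableSet {z : Fin n → Ω2 | inducedPerm z ∈ S} := by
  classical
  have hG : MeasurableSet (⋃ π : Equiv.Perm (Fin n), patSet π) :=
    MeasurableSet.iUnion fun π => (isOpen_patSet π).measurableSet
  have hS : MeasurableSet (⋃ π ∈ S, patSet π) :=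
    MeasurableSet.biUnion (Set.to_countable S) fun π _ => (isOpen_patSet π).measurableSet
  have : {z : Fin n → Ω2 | inducedPerm z ∈ S}
      = (⋃ π ∈ S, patSet π) ∪ (if (1 : Equiv.Perm (Fin n)) ∈ S
        then (⋃ π : Equiv.Perm (Fin n), patSet π)ᶜ else ∅) := by
    ext z
    by_cases hz : ∃ π, z ∈ patSet π
    · obtain ⟨π, hπ⟩ := hz
      have h1 : (∃ π', z ∈ patSet π') := ⟨π, hπ⟩
      have h2 : (∃ i ∈ S, z ∈ patSet i) ↔ π ∈ S :=
        ⟨fun ⟨i, hi, hz⟩ => patSet_inj hπ hz ▸ hi, fun h => ⟨π, h, hπ⟩⟩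
      by_cases h : (1 : Equiv.Perm (Fin n)) ∈ S <;> simp [inducedPerm_eq hπ, h, h1, h2]
    · have hn : inducedPerm z = 1 := by
        rw [inducedPerm, dif_neg]
        simpa only [hPat_eq_one_iff] using hz
      have h2 := not_exists.1 hz
      by_cases h : (1 : Equiv.Perm (Fin n)) ∈ S <;> simp [hn, h, h2]
  rw [this]
  refine hS.union ?_
  split_ifs
  exacts [hG.compl, MeasurableSet.empty]

theorem ae_ne_of_atomless {ν : Measure Ω2} [IsProbabilityMeasure ν] {f : Ω2 → ℝ}
    (hf : Measurable f) (h : ∀ x, ν.map f {x} = 0) {n : ℕ} {i j : Fin n} (hij : i ≠ j) :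
    ∀ᵐ z ∂(Measure.pi fun _ : Fin n => ν), f (z i) ≠ f (z j) := by
  have hm := Measure.infinitePi_map_eval_prod (P := fun _ : Fin n => ν) hij
  rw [Measure.infinitePi_eq_pi] at hm
  have hs : MeasurableSet {p : Ω2 × Ω2 | f p.1 = f p.2} :=
    measurableSet_eq_fun (hf.comp measurable_fst) (hf.comp measurable_snd)
  have h0 : (ν.prod ν) {p : Ω2 × Ω2 | f p.1 = f p.2} = 0 := by
    rw [Measure.measure_prod_null hs]
    refine ae_of_all _ fun p => ?_
    have := h (f p)
    rw [Measure.map_apply hf (measurableSet_singleton _)] at this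
    refine measure_mono_null (fun q hq => ?_) this
    exact (Eq.symm hq : f q = f p)
  rw [← hm, Measure.map_apply (by fun_prop) hs] at h0
  rw [ae_iff]
  simpa using h0

theorem ae_exists_mem_patSet {ν : ProbabilityMeasure Ω2} (h : ν ∈ Mcal) (n : ℕ) :
    ∀ᵐ z ∂(Measure.pi fun _ : Fin n => (ν : Measure Ω2)), ∃ π, z ∈ patSet π := by
  have h1 : ∀ᵐ z ∂(Measure.pi fun _ : Fin n => (ν : Measure Ω2)),
      ∀ i j, i ≠ j → (z i).1 ≠ (z j).1 := by
    simp only [ae_all_iff]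
    exact fun i j hij => ae_ne_of_atomless measurable_fst h.2.1 hij
  have h2 : ∀ᵐ z ∂(Measure.pi fun _ : Fin n => (ν : Measure Ω2)),
      ∀ i j, i ≠ j → (z i).2 ≠ (z j).2 := by
    simp only [ae_all_iff]
    exact fun i j hij => ae_ne_of_atomless measurable_snd h.2.2 hij
  filter_upwards [h1, h2] with z h1 h2
  refine exists_mem_patSet (fun i j hij => ?_) fun i j hij => ?_
  · by_contra hne; exact h1 i j hne hij
  · by_contra hne; exact h2 i j hne hij

theorem tPat_eq {k : ℕ} (σ : Equiv.Perm (Fin k)) (ν : Measure Ω2) :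
    tPat σ ν = ((Measure.pi fun _ : Fin k => ν) (patSet σ)).toReal := by
  rw [tPat, hPat_eq_indicator, integral_indicator (isOpen_patSet σ).measurableSet]
  simp [measureReal_def]

theorem tPat_nonneg {k : ℕ} (σ : Equiv.Perm (Fin k)) (ν : Measure Ω2) : 0 ≤ tPat σ ν := by
  rw [tPat_eq]; positivity

theorem tPat_le_one {k : ℕ} (σ : Equiv.Perm (Fin k)) (ν : Measure Ω2) [IsProbabilityMeasure ν] :
    tPat σ ν ≤ 1 := by
  rw [tPat_eq]; exact measureReal_le_one

theorem abs_mul_tPat_le {k : ℕ} (σ : Equiv.Perm (Fin k)) (θ : ℝ) (ν : Measure Ω2)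
    [IsProbabilityMeasure ν] : |θ * tPat σ ν| ≤ |θ| := by
  rw [abs_mul, abs_of_nonneg (tPat_nonneg _ _)]
  exact mul_le_of_le_one_right (abs_nonneg _) (tPat_le_one _ _)

theorem continuousAt_tPat {k : ℕ} (σ : Equiv.Perm (Fin k)) {ν : ProbabilityMeasure Ω2}
    (h : ν ∈ Mcal) : ContinuousAt (fun ρ : ProbabilityMeasure Ω2 => tPat σ (ρ : Measure Ω2)) ν := by
  simp_rw [ContinuousAt, tPat_eq]
  have hc : Continuous fun ρ : ProbabilityMeasure Ω2 =>
      ProbabilityMeasure.pi (fun _ : Fin k => ρ) :=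
    ProbabilityMeasure.continuous_pi.comp (continuous_pi fun _ => continuous_id)
  refine (tendsto_toReal_measure_of_null_frontier
    (ν := ProbabilityMeasure.pi (fun _ : Fin k => ν)) (s := patSet σ) ?_).comp (hc.tendsto ν)
  refine measure_mono_null ?_ (ae_exists_mem_patSet h k)
  rintro z hz ⟨π, hπ⟩
  rw [(isOpen_patSet σ).frontier_eq] at hz
  obtain ⟨w, hw1, hw2⟩ := mem_closure_iff.1 hz.1 _ (isOpen_patSet π) hπ
  exact hz.2 (patSet_inj hw1 hw2 ▸ hπ)

/-- The empirical measure of `n` points. -/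
def empM {n : ℕ} (z : Fin n → Ω2) : Measure Ω2 :=
  (n : ℝ≥0∞)⁻¹ • ∑ i : Fin n, Measure.dirac (z i)

theorem isProbabilityMeasure_inv_smul_sum_dirac {n : ℕ} (hn : n ≠ 0) (z : Fin n → Ω2) :
    IsProbabilityMeasure (empM z) := by
  refine ⟨?_⟩
  have h0 : (n : ℝ≥0∞) ≠ 0 := by exact_mod_cast hn
  simp [empM, ENNReal.inv_mul_cancel h0 (ENNReal.natCast_ne_top n)]

theorem EmM_eq_empM {n : ℕ} (π : Equiv.Perm (Fin n)) :
    EmM π = empM fun i => ((((i : ℕ) + 1 : ℝ)) / n, (((π i : ℕ) + 1 : ℝ)) / n) := rfl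

theorem empM_preimage_Iic {n : ℕ} (z : Fin n → Ω2) {f : Ω2 → ℝ} (hf : Measurable f)
    {e : Equiv.Perm (Fin n)} (h : StrictMono fun i => f (z (e i))) (i : Fin n) :
    (empM z {p | f p ≤ f (z (e i))}).toReal = ((i : ℕ) + 1 : ℝ) / n := by
  have hm : MeasurableSet {p | f p ≤ f (z (e i))} := hf measurableSet_Iic
  have hc := card_filter_le_of_strictMono (w := fun j => f (z j)) h i
  have : ∑ j : Fin n, (Measure.dirac (z j)) {p | f p ≤ f (z (e i))} = ((i : ℕ) + 1 : ℕ) := by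
    rw [← hc, Finset.card_filter]
    push_cast
    refine Finset.sum_congr rfl fun j _ => ?_
    rw [Measure.dirac_apply' _ hm]
    simp [Set.indicator]
  simp only [empM, Measure.smul_apply, Measure.finsetSum_apply, this, smul_eq_mul,
    ENNReal.toReal_mul, ENNReal.toReal_inv, ENNReal.toReal_natCast]
  push_cast
  ring

theorem Omap_empM {n : ℕ} {z : Fin n → Ω2} {π : Equiv.Perm (Fin n)} (h : z ∈ patSet π) :
    Omap (empM z) = EmM π := by
  obtain ⟨τ, h1, h2⟩ := h
  rcases Nat.eq_zero_or_pos n with rfl | hn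
  · simp [Omap, empM, EmM]
  have := isProbabilityMeasure_inv_smul_sum_dirac hn.ne' z
  have hm : Measurable (cdfMap (empM z)) := measurable_cdfMap _
  have hx : ∀ i, cdfX (empM z) (z (τ i)).1 = ((i : ℕ) + 1 : ℝ) / n := fun i =>
    empM_preimage_Iic z measurable_fst h1 i
  have hy : ∀ i, cdfY (empM z) (z (τ i)).2 = ((π i : ℕ) + 1 : ℝ) / n := fun i => by
    have := empM_preimage_Iic z measurable_snd (e := τ * π⁻¹) h2 (π i)
    change (empM z {p | p.2 ≤ (z (τ i)).2}).toReal = _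
    simpa using this
  change (empM z).map (cdfMap (empM z)) = _
  have hΦ (i : Fin n) : cdfMap (empM z) (z (τ i))
      = ((((i : ℕ) + 1 : ℝ)) / n, (((π i : ℕ) + 1 : ℝ)) / n) := by rw [cdfMap, hx, hy]
  generalize cdfMap (empM z) = Φ at hm hΦ
  rw [empM]
  rw [Measure.map_smul, Measure.map_finset_sum hm.aemeasurable, EmM,
    ← Equiv.sum_comp τ]
  congr 1
  refine Finset.sum_congr rfl fun i _ => ?_
  rw [Measure.map_dirac' hm, hΦ]

theorem tPat_map_of_strictMonoOn {k : ℕ} (σ : Equiv.Perm (Fin k)) {ρ : Measure Ω2}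
    [IsProbabilityMeasure ρ] {φ : Ω2 → Ω2} (hφ : Measurable φ) {s : Set Ω2}
    (hs : ∀ᵐ p ∂ρ, p ∈ s)
    (h1 : ∀ p ∈ s, ∀ q ∈ s, (φ p).1 < (φ q).1 ↔ p.1 < q.1)
    (h2 : ∀ p ∈ s, ∀ q ∈ s, (φ p).2 < (φ q).2 ↔ p.2 < q.2) :
    tPat σ (ρ.map φ) = tPat σ ρ := by
  have := Measure.isProbabilityMeasure_map (μ := ρ) hφ.aemeasurable
  have hk : ∀ᵐ z ∂(Measure.pi fun _ : Fin k => ρ), ∀ i, z i ∈ s := by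
    rw [ae_all_iff]
    exact fun i => (Measure.quasiMeasurePreserving_eval (fun _ : Fin k => ρ) i).ae hs
  rw [tPat, ← Measure.pi_map_pi fun _ => hφ.aemeasurable, integral_map, tPat]
  · refine integral_congr_ae ?_
    filter_upwards [hk] with z hz
    simp only [hPat, StrictMono, h1 _ (hz _) _ (hz _), h2 _ (hz _) _ (hz _)]
    congr
  · exact Measurable.aemeasurable (by fun_prop)
  · rw [hPat_eq_indicator]
    exact (measurable_const.indicator (isOpen_patSet σ).measurableSet).aestronglyMeasurable

theorem tPerm_inducedPerm {k n : ℕ} (hn : n ≠ 0) (σ : Equiv.Perm (Fin k)) {z : Fin n → Ω2}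
    {π : Equiv.Perm (Fin n)} (h : z ∈ patSet π) : tPerm σ π = tPat σ (empM z) := by
  have := isProbabilityMeasure_inv_smul_sum_dirac hn z
  rw [tPerm, ← Omap_empM h]
  obtain ⟨τ, h1, h2⟩ := h
  have hx : ∀ i, cdfX (empM z) (z (τ i)).1 = ((i : ℕ) + 1 : ℝ) / n := fun i =>
    empM_preimage_Iic z measurable_fst h1 i
  have hy : ∀ i, cdfY (empM z) (z ((τ * π⁻¹) i)).2 = ((i : ℕ) + 1 : ℝ) / n := fun i =>
    empM_preimage_Iic z measurable_snd (e := τ * π⁻¹) h2 i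
  have hn' : (0 : ℝ) < n := by positivity
  have hlt : ∀ i j : Fin n, ((i : ℕ) + 1 : ℝ) / n < ((j : ℕ) + 1 : ℝ) / n ↔ i < j := fun i j => by
    rw [div_lt_div_iff_of_pos_right hn', add_lt_add_iff_right, Nat.cast_lt, Fin.lt_def]
  refine tPat_map_of_strictMonoOn σ (measurable_cdfMap (empM z)) (s := Set.range z) ?_ ?_ ?_
  · rw [empM]
    refine Measure.ae_smul_measure ?_ _
    rw [ae_iff, Measure.finsetSum_apply]
    refine Finset.sum_eq_zero fun i _ => ?_
    have : {a | ¬ a ∈ Set.range z} = (Set.range z)ᶜ := rfl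
    rw [this, Measure.dirac_apply' _ (Set.finite_range z).measurableSet.compl]
    simp
  · rintro _ ⟨i, rfl⟩ _ ⟨j, rfl⟩
    obtain ⟨i, rfl⟩ := τ.surjective i
    obtain ⟨j, rfl⟩ := τ.surjective j
    change cdfX _ _ < cdfX _ _ ↔ _
    rw [hx, hx, hlt, ← h1.lt_iff_lt (a := i)]
  · rintro _ ⟨i, rfl⟩ _ ⟨j, rfl⟩
    obtain ⟨i, rfl⟩ := (τ * π⁻¹).surjective i
    obtain ⟨j, rfl⟩ := (τ * π⁻¹).surjective j
    change cdfY _ _ < cdfY _ _ ↔ _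
    rw [hy, hy, hlt, ← h2.lt_iff_lt (a := i)]
    rfl

/-- The empirical measure of `n ≠ 0` points, as a probability measure. -/
def empP {n : ℕ} [NeZero n] (z : Fin n → Ω2) : ProbabilityMeasure Ω2 :=
  ⟨empM z, isProbabilityMeasure_inv_smul_sum_dirac (NeZero.ne n) z⟩

theorem integral_empM {n : ℕ} (z : Fin n → Ω2) (f : Ω2 → ℝ) :
    ∫ p, f p ∂(empM z) = (n : ℝ)⁻¹ * ∑ i, f (z i) := by
  rw [empM, integral_smul_measure, integral_finsetSum_measure fun i _ => integrable_dirac (by simp)]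
  simp

theorem measurable_comp_inducedPerm {n : ℕ} {β : Type*} [MeasurableSpace β]
    (g : Equiv.Perm (Fin n) → β) : Measurable fun z : Fin n → Ω2 => g (inducedPerm z) :=
  fun s _ => measurableSet_inducedPerm (g ⁻¹' s)

instance (μ : ProbabilityMeasure Ω2) (n : ℕ) : IsProbabilityMeasure (pmeas μ n) := by
  unfold pmeas; infer_instance

theorem ae_inducedPerm {k : ℕ} (σ : Equiv.Perm (Fin k)) {μ : ProbabilityMeasure Ω2}
    (hμ : μ ∈ Mcal) (n : ℕ) [NeZero n] :
    ∀ᵐ z ∂(pmeas μ n), EmP (inducedPerm z) = OmapP (empP z) ∧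
      tPerm σ (inducedPerm z) = tPat σ (empM z) ∧ empP z ∈ Pcal := by
  have hk : ∀ᵐ z ∂(pmeas μ n), ∀ i, z i ∈ unitSq := by
    rw [ae_all_iff]
    exact fun i => (Measure.quasiMeasurePreserving_eval (fun _ : Fin n => (μ : Measure Ω2)) i).ae
      (ae_mem_unitSq hμ.1)
  filter_upwards [ae_exists_mem_patSet hμ n, hk] with z ⟨π, hπ⟩ hz
  rw [inducedPerm_eq hπ]
  refine ⟨?_, tPerm_inducedPerm (NeZero.ne n) σ hπ, ?_⟩
  · have h : IsProbabilityMeasure (EmM π) := by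
      rw [EmM_eq_empM]; exact isProbabilityMeasure_inv_smul_sum_dirac (NeZero.ne n) _
    have hE : EmP π = ⟨EmM π, h⟩ := dif_pos h
    rw [hE]
    exact Subtype.ext (Omap_empM hπ).symm
  · change empM z unitSq = 1
    have : IsProbabilityMeasure (empM z) := (empP z).2
    rw [prob_compl_eq_zero_iff measurableSet_unitSq |>.symm, empM, Measure.smul_apply,
      Measure.finsetSum_apply]
    simp [Measure.dirac_apply' _ measurableSet_unitSq.compl, hz]

theorem pmeas_integral_empM_gt_le (μ : ProbabilityMeasure Ω2) {f : BoundedContinuousFunction Ω2 ℝ}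
    (hf : ∫ x, Real.exp (f x) ∂(μ : Measure Ω2) ≤ 1) (b : ℝ) (n : ℕ) [NeZero n] :
    pmeas μ n {z | b < ∫ p, f p ∂(empM z)} ≤ ENNReal.ofReal (Real.exp (-(n * b))) := by
  have hn : (0 : ℝ) < n := by exact_mod_cast Nat.pos_of_ne_zero (NeZero.ne n)
  have hfm : Measurable f := f.continuous.measurable
  have hm : Measurable fun z : Fin n → Ω2 => ∏ i, Real.exp (f (z i)) :=
    Finset.measurable_prod _ fun i _ => (hfm.comp (measurable_pi_apply i)).exp
  have hi : Integrable (fun z : Fin n → Ω2 => ∏ i, Real.exp (f (z i))) (pmeas μ n) :=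
    Integrable.fintype_prod fun _ =>
      integrable_exp_of_abs_le (μ := (μ : Measure Ω2)) hfm f.norm_coe_le_norm
  have h1 : ∫⁻ z, ENNReal.ofReal (∏ i, Real.exp (f (z i))) ∂(pmeas μ n) ≤ 1 := by
    rw [← ofReal_integral_eq_lintegral_ofReal hi
      (ae_of_all _ fun z => Finset.prod_nonneg fun i _ => (Real.exp_pos _).le), pmeas,
      integral_fintype_prod_eq_pow fun x => Real.exp (f x)]
    exact ENNReal.ofReal_le_one.2 (pow_le_one₀ (integral_nonneg fun _ => (Real.exp_pos _).le) hf)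
  have h2 := (mul_meas_ge_le_lintegral hm.ennreal_ofReal
    (ENNReal.ofReal (Real.exp (n * b)))).trans h1
  rw [Real.exp_neg, ENNReal.ofReal_inv_of_pos (Real.exp_pos _), ENNReal.le_inv_iff_mul_le, mul_comm]
  refine le_trans (mul_le_mul_right (measure_mono fun z hz => ?_) _) h2
  refine ENNReal.ofReal_le_ofReal ?_
  rw [← Real.exp_sum, Real.exp_le_exp]
  have hz : b < ∫ p, f p ∂(empM z) := hz
  rw [integral_empM, ← div_eq_inv_mul, lt_div_iff₀ hn] at hz
  linarith

theorem exists_dual_of_coe_lt_KL (ν μ : Measure Ω2) [IsProbabilityMeasure ν]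
    [IsProbabilityMeasure μ] {b : ℝ} (h : (b : EReal) < (KL ν μ : ℝ≥0∞)) :
    ∃ f : BoundedContinuousFunction Ω2 ℝ, ∫ x, Real.exp (f x) ∂μ ≤ 1 ∧ b < ∫ x, f x ∂ν := by
  rcases le_or_gt 0 b with hb | hb
  · refine exists_dual_of_lt_KL ν μ ?_
    rwa [← EReal.coe_ennreal_lt_coe_ennreal_iff, EReal.coe_ennreal_ofReal, max_eq_left hb]
  · exact ⟨0, by simp, by simpa using hb⟩

theorem KL_eq_top_of_notMem_Mcal {μ : ProbabilityMeasure Ω2} (hμ : μ ∈ Mcal)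
    {ν : ProbabilityMeasure Ω2} (hν : ν ∈ Pcal) (h : ν ∉ Mcal) : KL ν μ = ∞ := by
  rw [KL, if_neg]
  exact fun hac => h ⟨hν, fun x => hac.map measurable_fst (hμ.2.1 x),
    fun x => hac.map measurable_snd (hμ.2.2 x)⟩

/-- The functional `ν ↦ D(ν|μ) − θ t_σ(ν)`. -/
def freeEnergy {k : ℕ} (σ : Equiv.Perm (Fin k)) (μ : Measure Ω2) (θ : ℝ)
    (ν : ProbabilityMeasure Ω2) : EReal :=
  ((KL (↑ν) μ : ℝ≥0∞) : EReal) - ((θ * tPat σ (ν : Measure Ω2) : ℝ) : EReal)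

/-- The weight `E[exp(nθ t_σ(π_{n,μ})); Em(π_{n,μ}) ∈ A]`. -/
def gibbsWeight {k : ℕ} (σ : Equiv.Perm (Fin k)) (μ : Measure Ω2) (θ : ℝ) (n : ℕ)
    (A : Set (ProbabilityMeasure Ω2)) : ℝ≥0∞ :=
  ∫⁻ z in {z | EmP (inducedPerm z) ∈ A},
    ENNReal.ofReal (Real.exp (n * θ * tPerm σ (inducedPerm z))) ∂(pmeas μ n)

theorem setLIntegral_empP_le {k : ℕ} (σ : Equiv.Perm (Fin k)) (μ : ProbabilityMeasure Ω2) (θ : ℝ)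
    {b c : ℝ} {f : BoundedContinuousFunction Ω2 ℝ}
    (hf : ∫ x, Real.exp (f x) ∂(μ : Measure Ω2) ≤ 1) (n : ℕ) [NeZero n] {s : Set (Fin n → Ω2)}
    (hs : ∀ z ∈ s, θ * tPat σ (empM z) ≤ c ∧ b < ∫ p, f p ∂(empM z)) :
    ∫⁻ z in s, ENNReal.ofReal (Real.exp (n * θ * tPat σ (empM z))) ∂(pmeas μ n) ≤
      ENNReal.ofReal (Real.exp (-(n * (b - c)))) := by
  calc _ ≤ ∫⁻ z in s, ENNReal.ofReal (Real.exp (n * c)) ∂(pmeas μ n) := by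
        refine setLIntegral_mono measurable_const fun z hz => ENNReal.ofReal_le_ofReal ?_
        rw [Real.exp_le_exp, mul_assoc]
        exact mul_le_mul_of_nonneg_left (hs z hz).1 (by positivity)
    _ = ENNReal.ofReal (Real.exp (n * c)) * pmeas μ n s := by simp
    _ ≤ ENNReal.ofReal (Real.exp (n * c)) * ENNReal.ofReal (Real.exp (-(n * b))) := by
        gcongr
        exact (measure_mono fun z hz => (hs z hz).2).trans (pmeas_integral_empM_gt_le μ hf b n)
    _ = _ := by
        rw [← ENNReal.ofReal_mul (Real.exp_pos _).le, ← Real.exp_add]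
        ring_nf

theorem isOpen_setOf_lt_integral (f : BoundedContinuousFunction Ω2 ℝ) (b : ℝ) :
    IsOpen {ρ : ProbabilityMeasure Ω2 | b < ∫ p, f p ∂(ρ : Measure Ω2)} :=
  isOpen_lt continuous_const
    (continuous_iff_continuousAt.2 fun _ =>
      ProbabilityMeasure.tendsto_iff_forall_integral_tendsto.1 tendsto_id f)

theorem gibbsWeight_le_of_isClosed {k : ℕ} (σ : Equiv.Perm (Fin k)) {μ : ProbabilityMeasure Ω2}
    (hμ : μ ∈ Mcal) (θ : ℝ) {C : Set (ProbabilityMeasure Ω2)} (hC : IsClosed C) {a : ℝ}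
    (h : ∀ ν ∈ Mcal, OmapP ν ∈ C → (a : EReal) < freeEnergy σ μ θ ν) :
    ∃ M : NNReal, ∀ n : ℕ, n ≠ 0 →
      gibbsWeight σ μ θ n C ≤ M * ENNReal.ofReal (Real.exp (-(n * a))) := by
  have key : ∃ M : NNReal, ∀ (n : ℕ) [NeZero n],
      ∫⁻ z in {z : Fin n → Ω2 | OmapP (empP z) ∈ C ∧ empP z ∈ Pcal},
        ENNReal.ofReal (Real.exp (n * θ * tPat σ (empM z))) ∂(pmeas μ n) ≤
      M * ENNReal.ofReal (Real.exp (-(n * a))) := by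
    refine isCompact_Pcal.induction_on (p := fun s => ∃ M : NNReal, ∀ (n : ℕ) [NeZero n],
      ∫⁻ z in {z : Fin n → Ω2 | OmapP (empP z) ∈ C ∧ empP z ∈ s},
        ENNReal.ofReal (Real.exp (n * θ * tPat σ (empM z))) ∂(pmeas μ n) ≤
      M * ENNReal.ofReal (Real.exp (-(n * a)))) ⟨0, by simp⟩ ?_ ?_ ?_
    · rintro s t hst ⟨M, hM⟩
      refine ⟨M, fun n _ => (lintegral_mono_set ?_).trans (hM n)⟩
      rintro z ⟨h1, h2⟩
      exact ⟨h1, hst h2⟩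
    · rintro s t ⟨M, hM⟩ ⟨N, hN⟩
      refine ⟨M + N, fun n _ => ?_⟩
      rw [ENNReal.coe_add, add_mul]
      refine le_trans ?_ (add_le_add (hM n) (hN n))
      refine (lintegral_mono_set ?_).trans (lintegral_union_le _ _ _)
      rintro z ⟨h1, h2 | h2⟩
      exacts [Or.inl ⟨h1, h2⟩, Or.inr ⟨h1, h2⟩]
    · intro ν hν
      by_cases hM : ν ∈ Mcal
      · by_cases hO : OmapP ν ∈ C
        · obtain ⟨b, hb1, hb2⟩ := EReal.lt_iff_exists_real_btwn.1
            (EReal.add_lt_of_lt_sub (h ν hM hO))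
          rw [← EReal.coe_add, EReal.coe_lt_coe_iff] at hb1
          obtain ⟨f, hf1, hf2⟩ := exists_dual_of_coe_lt_KL ν μ hb2
          have ht : ∀ᶠ ρ in 𝓝 ν, θ * tPat σ ((ρ : ProbabilityMeasure Ω2) : Measure Ω2) < b - a :=
            (continuousAt_tPat σ hM).const_mul θ |>.eventually_lt_const (by linarith)
          refine ⟨_, mem_nhdsWithin_of_mem_nhds
            (inter_mem ht ((isOpen_setOf_lt_integral f b).mem_nhds hf2)), 1, fun n _ => ?_⟩
          refine (setLIntegral_empP_le σ μ θ (b := b) (c := b - a) hf1 n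
            fun z hz => ⟨?_, hz.2.2⟩).trans ?_
          · exact (show θ * tPat σ (empM z) < b - a from hz.2.1).le
          · simp
        · have := (continuousWithinAt_OmapP hM) (hC.isOpen_compl.mem_nhds hO)
          refine ⟨_, this, 0, fun n _ => ?_⟩
          simp
      · obtain ⟨f, hf1, hf2⟩ := exists_dual_of_lt_KL ν μ (b := a + |θ|)
          (by rw [KL_eq_top_of_notMem_Mcal hμ hν hM]; simp)
        refine ⟨_, mem_nhdsWithin_of_mem_nhds ((isOpen_setOf_lt_integral f _).mem_nhds hf2), 1,
          fun n _ => ?_⟩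
        refine (setLIntegral_empP_le σ μ θ (b := a + |θ|) (c := |θ|) hf1 n
            fun z hz => ⟨?_, hz.2⟩).trans ?_
        · exact (le_abs_self _).trans (abs_mul_tPat_le σ θ (empP z : Measure Ω2))
        · simp
  obtain ⟨M, hM⟩ := key
  refine ⟨M, fun n hn => ?_⟩
  have : NeZero n := ⟨hn⟩
  refine le_trans (le_of_eq ?_) (hM n)
  have hae := ae_inducedPerm σ hμ n
  have hset : {z | EmP (inducedPerm z) ∈ C}
      =ᵐ[pmeas μ n] {z : Fin n → Ω2 | OmapP (empP z) ∈ C ∧ empP z ∈ Pcal} := by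
    filter_upwards [hae] with z hz
    change (EmP (inducedPerm z) ∈ C) = (OmapP (empP z) ∈ C ∧ empP z ∈ Pcal)
    simp [hz.1, hz.2.2]
  rw [gibbsWeight, setLIntegral_congr hset]
  refine lintegral_congr_ae (ae_restrict_of_ae ?_)
  filter_upwards [hae] with z hz
  rw [hz.2.1]

theorem lintegral_pi_prod {n : ℕ} (μ : Measure Ω2) [IsProbabilityMeasure μ]
    {f : Fin n → Ω2 → ℝ≥0∞} (hf : ∀ i, Measurable (f i)) :
    ∫⁻ z, ∏ i, f i (z i) ∂(Measure.pi fun _ : Fin n => μ) = ∏ i, ∫⁻ x, f i x ∂μ := by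
  rw [ProbabilityTheory.lintegral_prod_eq_prod_lintegral_of_indepFun Finset.univ
    (fun i (z : Fin n → Ω2) => f i (z i))
    (ProbabilityTheory.iIndepFun_pi fun i => (hf i).aemeasurable)
    fun i => (hf i).comp (measurable_pi_apply i)]
  refine Finset.prod_congr rfl fun i _ => ?_
  have h := measurePreserving_eval (fun _ : Fin n => μ) i
  exact h.lintegral_comp (hf i)

theorem pmeas_eq_withDensity {ν μ : Measure Ω2} [IsProbabilityMeasure ν] [IsProbabilityMeasure μ]
    (h : ν ≪ μ) (n : ℕ) :
    pmeas ν n = (pmeas μ n).withDensity fun z => ∏ i, ν.rnDeriv μ (z i) := by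
  refine Measure.pi_eq fun s hs => ?_
  have hg := Measure.measurable_rnDeriv ν μ
  rw [withDensity_apply _ (MeasurableSet.univ_pi hs), ← lintegral_indicator (MeasurableSet.univ_pi hs)]
  have : ((Set.univ.pi s).indicator fun z : Fin n → Ω2 => ∏ i, ν.rnDeriv μ (z i))
      = fun z => ∏ i, (s i).indicator (ν.rnDeriv μ) (z i) := by
    ext z
    by_cases hz : z ∈ Set.univ.pi s
    · rw [Set.indicator_of_mem hz]
      exact Finset.prod_congr rfl fun i _ => (Set.indicator_of_mem (hz i trivial) _).symm
    · rw [Set.indicator_of_notMem hz]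
      simp only [Set.mem_univ_pi, not_forall] at hz
      obtain ⟨i, hi⟩ := hz
      exact (Finset.prod_eq_zero (Finset.mem_univ i) (Set.indicator_of_notMem hi _)).symm
  rw [this, pmeas, lintegral_pi_prod μ fun i => hg.indicator (hs i)]
  refine Finset.prod_congr rfl fun i _ => ?_
  rw [lintegral_indicator (hs i), ← withDensity_apply _ (hs i), Measure.withDensity_rnDeriv_eq _ _ h]

theorem pmeas_le_of_sum_llr_le {ν μ : Measure Ω2} [IsProbabilityMeasure ν] [IsProbabilityMeasure μ]
    (h : ν ≪ μ) {n : ℕ} {G : Set (Fin n → Ω2)} (hG : MeasurableSet G) {c : ℝ}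
    (hc : ∀ z ∈ G, ∑ i, llr ν μ (z i) ≤ c) :
    pmeas ν n G ≤ ENNReal.ofReal (Real.exp c) * pmeas μ n G := by
  rw [pmeas_eq_withDensity h, withDensity_apply _ hG, ← setLIntegral_const]
  refine setLIntegral_mono_ae measurable_const.aemeasurable ?_
  have hk : ∀ᵐ z ∂(pmeas μ n), ∀ i, ν.rnDeriv μ (z i) < ∞ := by
    rw [ae_all_iff]
    exact fun i => (Measure.quasiMeasurePreserving_eval (fun _ : Fin n => μ) i).ae
      (Measure.rnDeriv_lt_top ν μ)
  filter_upwards [hk] with z hz hzG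
  by_cases h0 : ∃ i, ν.rnDeriv μ (z i) = 0
  · obtain ⟨i, hi⟩ := h0
    rw [Finset.prod_eq_zero (Finset.mem_univ i) hi]
    exact zero_le
  · push Not at h0
    refine le_trans (le_of_eq ?_) (ENNReal.ofReal_le_ofReal (Real.exp_le_exp.2 (hc z hzG)))
    rw [Real.exp_sum, ENNReal.ofReal_prod_of_nonneg fun i _ => (Real.exp_pos _).le]
    refine Finset.prod_congr rfl fun i _ => ?_
    rw [llr, Real.exp_log (ENNReal.toReal_pos (h0 i) (hz i).ne), ENNReal.ofReal_toReal (hz i).ne]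

/-- The first `n` points of a sequence. -/
def firstPoints (n : ℕ) (ω : ℕ → Ω2) : Fin n → Ω2 := fun i => ω i

theorem measurePreserving_firstPoints (ν : Measure Ω2) [IsProbabilityMeasure ν] (n : ℕ) :
    MeasurePreserving (firstPoints n) (Measure.infinitePi fun _ : ℕ => ν) (pmeas ν n) := by
  refine ⟨measurable_pi_lambda _ fun i => measurable_pi_apply _, ?_⟩
  rw [pmeas, ← Measure.infinitePi_eq_pi]
  exact Measure.map_infinitePi_infinitePi_of_inj (P := fun _ : ℕ => ν) Fin.val_injective

theorem ae_tendsto_average (ν : Measure Ω2) [IsProbabilityMeasure ν] {g : Ω2 → ℝ}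
    (hg : Measurable g) (hi : Integrable g ν) :
    ∀ᵐ ω ∂(Measure.infinitePi fun _ : ℕ => ν),
      Tendsto (fun n : ℕ => ((n + 1 : ℕ) : ℝ)⁻¹ * ∑ i, g (firstPoints (n + 1) ω i)) atTop
        (𝓝 (∫ x, g x ∂ν)) := by
  have hp (i : ℕ) := measurePreserving_eval_infinitePi (fun _ : ℕ => ν) i
  have hind := ProbabilityTheory.iIndepFun_infinitePi (P := fun _ : ℕ => ν) (X := fun _ => g)
    fun _ => hg
  have h := ProbabilityTheory.strong_law_ae_real (μ := Measure.infinitePi fun _ : ℕ => ν)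
    (fun i ω => g (ω i)) ((hp 0).integrable_comp_of_integrable hi)
    (fun i j hij => hind.indepFun hij) fun i =>
      ⟨(hg.comp (measurable_pi_apply i)).aemeasurable,
        (hg.comp (measurable_pi_apply 0)).aemeasurable, by
        have h1 := Measure.map_map (μ := Measure.infinitePi fun _ : ℕ => ν) hg
          (measurable_pi_apply i)
        have h2 := Measure.map_map (μ := Measure.infinitePi fun _ : ℕ => ν) hg
          (measurable_pi_apply 0)
        rw [Function.comp_def] at h1 h2
        rw [← h1, ← h2]
        exact congrArg _ ((hp i).map_eq.trans (hp 0).map_eq.symm)⟩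
  have h0 : ∫ ω, g (ω 0) ∂(Measure.infinitePi fun _ : ℕ => ν) = ∫ x, g x ∂ν := by
    have := integral_map (μ := Measure.infinitePi fun _ : ℕ => ν)
      (hp 0).measurable.aemeasurable (f := g) hg.aestronglyMeasurable
    rw [(hp 0).map_eq] at this
    exact this.symm
  filter_upwards [h] with ω hω
  rw [h0] at hω
  refine (hω.comp (tendsto_add_atTop_nat 1)).congr fun n => ?_
  simp only [Function.comp, firstPoints]
  rw [Fin.sum_univ_eq_sum_range fun i => g (ω i), div_eq_inv_mul]

theorem tendsto_empP {ν : ProbabilityMeasure Ω2} (hν : ν ∈ Mcal) :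
    Tendsto (fun p : (ℕ → Ω2) × ℕ => empP (firstPoints (p.2 + 1) p.1))
      ((ae (Measure.infinitePi fun _ : ℕ => (ν : Measure Ω2))).curry atTop) (𝓝[Pcal] ν) := by
  refine tendsto_nhdsWithin_iff.2 ⟨?_, ?_⟩
  · refine ProbabilityMeasure.tendsto_iff_forall_integral_tendsto.2 fun f s hs => ?_
    have hfi : Integrable f (ν : Measure Ω2) :=
      integrable_of_abs_le f.continuous.measurable f.norm_coe_le_norm
    refine Filter.mem_map.2 <| (Filter.eventually_curry_iff (p := fun p : (ℕ → Ω2) × ℕ =>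
      ∫ x, f x ∂(empM (firstPoints (p.2 + 1) p.1)) ∈ s)).2 ?_
    filter_upwards [ae_tendsto_average (ν : Measure Ω2) f.continuous.measurable hfi] with ω hω
    filter_upwards [hω hs] with n hn
    rwa [integral_empM]
  · refine Filter.eventually_curry_iff.2 ?_
    have : ∀ n : ℕ, ∀ᵐ ω ∂(Measure.infinitePi fun _ : ℕ => (ν : Measure Ω2)),
        empP (firstPoints (n + 1) ω) ∈ Pcal := fun n =>
      (measurePreserving_firstPoints (ν : Measure Ω2) (n + 1)).quasiMeasurePreserving.ae
        ((ae_inducedPerm (1 : Equiv.Perm (Fin 0)) hν (n + 1)).mono fun z hz => hz.2.2)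
    filter_upwards [ae_all_iff.2 this] with ω hω
    exact Eventually.of_forall hω

theorem le_gibbsWeight_of_isOpen {k : ℕ} (σ : Equiv.Perm (Fin k)) {μ : ProbabilityMeasure Ω2}
    (θ : ℝ) {U : Set (ProbabilityMeasure Ω2)} (hU : IsOpen U)
    {ν : ProbabilityMeasure Ω2} (hν : ν ∈ Mcal) (hνU : OmapP ν ∈ U) {a : ℝ}
    (h : freeEnergy σ μ θ ν < a) :
    ∀ᶠ n : ℕ in atTop, ENNReal.ofReal (Real.exp (-(n * a))) ≤ gibbsWeight σ μ θ n U := by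
  have hKL : KL ν μ ≠ ∞ := by
    intro hK
    rw [freeEnergy, hK, EReal.coe_ennreal_top, EReal.top_sub_coe] at h
    exact not_top_lt h
  obtain ⟨hac, hllr⟩ := InformationTheory.klDiv_ne_top_iff.1 (KL_eq_klDiv (ν : Measure Ω2) μ ▸ hKL)
  have hD : (KL ν μ).toReal = ∫ x, llr (ν : Measure Ω2) μ x ∂(ν : Measure Ω2) := by
    rw [KL_eq_klDiv]
    exact InformationTheory.toReal_klDiv_of_measure_eq hac (by simp)
  set D := (KL ν μ).toReal
  have hDa : D - θ * tPat σ (ν : Measure Ω2) < a := by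
    have hK : ((KL ν μ : ℝ≥0∞) : EReal) = (D : EReal) := (EReal.coe_ennreal_toReal hKL).symm
    rw [freeEnergy, hK, ← EReal.coe_sub] at h
    exact_mod_cast h
  set t := θ * tPat σ (ν : Measure Ω2)
  obtain ⟨ε, hε, hεa⟩ : ∃ ε > 0, t - ε - (D + ε) = -a + ε :=
    ⟨(a - D + t) / 3, by linarith, by ring⟩
  let P : Measure (ℕ → Ω2) := Measure.infinitePi fun _ : ℕ => (ν : Measure Ω2)
  let G : (n : ℕ) → Set (Fin n → Ω2) := fun n =>
    {z | EmP (inducedPerm z) ∈ U ∧ t - ε < θ * tPerm σ (inducedPerm z)} ∩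
      {z | ∑ i, llr (ν : Measure Ω2) μ (z i) ≤ n * (D + ε)}
  have hG (n : ℕ) : MeasurableSet (G n) :=
    (measurableSet_inducedPerm {π | EmP π ∈ U ∧ t - ε < θ * tPerm σ π}).inter
      (measurableSet_le (Finset.measurable_sum _ fun i _ =>
        (measurable_llr _ _).comp (measurable_pi_apply i)) measurable_const)
  have hev : ∀ᵐ ω ∂P, ∀ᶠ n : ℕ in atTop, firstPoints (n + 1) ω ∈ G (n + 1) := by
    have h1 := Filter.eventually_curry_iff.1 ((tendsto_empP hν).eventually
      ((continuousWithinAt_OmapP hν).eventually (hU.mem_nhds hνU)))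
    have h2 := Filter.eventually_curry_iff.1 ((tendsto_empP hν).eventually
      (eventually_nhdsWithin_of_eventually_nhds
        (((continuousAt_tPat σ hν).const_mul θ).eventually_const_lt
          (show t - ε < t by linarith))))
    have h3 := ae_tendsto_average (ν : Measure Ω2) (measurable_llr (ν : Measure Ω2) μ) hllr
    have h4 : ∀ᵐ ω ∂P, ∀ n : ℕ,
        EmP (inducedPerm (firstPoints (n + 1) ω)) = OmapP (empP (firstPoints (n + 1) ω)) ∧
        tPerm σ (inducedPerm (firstPoints (n + 1) ω)) = tPat σ (empM (firstPoints (n + 1) ω)) :=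
      ae_all_iff.2 fun n =>
        (measurePreserving_firstPoints (ν : Measure Ω2) (n + 1)).quasiMeasurePreserving.ae
          (p := fun z => EmP (inducedPerm z) = OmapP (empP z) ∧
            tPerm σ (inducedPerm z) = tPat σ (empM z))
          ((ae_inducedPerm σ hν (n + 1)).mono fun z hz => ⟨hz.1, hz.2.1⟩)
    filter_upwards [h1, h2, h3, h4] with ω h1 h2 h3 h4
    filter_upwards [h1, h2, h3.eventually_lt_const (show _ < D + ε by linarith)] with n h1 h2 h3
    refine ⟨⟨?_, ?_⟩, ?_⟩
    · rw [(h4 n).1]; exact h1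
    · rw [(h4 n).2]; exact h2
    · rw [← div_eq_inv_mul, div_lt_iff₀ (by positivity), mul_comm] at h3
      exact h3.le
  have hlim : Tendsto (fun n : ℕ => P (firstPoints (n + 1) ⁻¹' G (n + 1))) atTop
      (𝓝 (P Set.univ)) := by
    refine tendsto_measure_of_ae_tendsto_indicator_of_isFiniteMeasure atTop MeasurableSet.univ
      (fun n => (measurePreserving_firstPoints (ν : Measure Ω2) _).measurable (hG _)) ?_
    filter_upwards [hev] with ω hω
    filter_upwards [hω] with n hn
    simpa using hn
  rw [show P Set.univ = 1 from measure_univ] at hlim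
  have hhalf : ∀ᶠ n : ℕ in atTop, ENNReal.ofReal (1 / 2) ≤ pmeas ν n (G n) := by
    have : Tendsto (fun n => pmeas ν n (G n)) atTop (𝓝 1) :=
      (tendsto_add_atTop_iff_nat 1).1 (hlim.congr fun n =>
        (measurePreserving_firstPoints _ _).measure_preimage (hG _).nullMeasurableSet)
    exact this.eventually_const_le (ENNReal.ofReal_lt_one.2 (by norm_num))
  have hexp : ∀ᶠ n : ℕ in atTop, 2 ≤ Real.exp (n * ε) :=
    (Real.tendsto_exp_atTop.comp
      (tendsto_natCast_atTop_atTop.atTop_mul_const hε)).eventually_ge_atTop 2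
  filter_upwards [hhalf, hexp] with n h1 h2
  have hle : pmeas ν n (G n) ≤ ENNReal.ofReal (Real.exp (n * (D + ε))) * pmeas μ n (G n) :=
    pmeas_le_of_sum_llr_le hac (hG n) fun z hz => hz.2
  have hge : ENNReal.ofReal (Real.exp (n * (t - ε))) * pmeas μ n (G n) ≤ gibbsWeight σ μ θ n U := by
    rw [← setLIntegral_const]
    refine le_trans (setLIntegral_mono
      (measurable_comp_inducedPerm fun π => ENNReal.ofReal (Real.exp (n * θ * tPerm σ π)))
      fun z hz => ENNReal.ofReal_le_ofReal ?_) (lintegral_mono_set fun z hz => hz.1.1)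
    rw [Real.exp_le_exp, mul_assoc]
    exact mul_le_mul_of_nonneg_left hz.1.2.le (by positivity)
  calc ENNReal.ofReal (Real.exp (-(n * a)))
      ≤ ENNReal.ofReal (Real.exp (n * (t - ε - (D + ε))) * (1 / 2)) := by
        refine ENNReal.ofReal_le_ofReal ?_
        rw [hεa, mul_add, Real.exp_add, mul_neg, mul_assoc]
        exact le_mul_of_one_le_right (Real.exp_pos _).le (by linarith)
    _ = ENNReal.ofReal (Real.exp (n * (t - ε))) * (ENNReal.ofReal (Real.exp (-(n * (D + ε)))) *
          ENNReal.ofReal (1 / 2)) := by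
        rw [← ENNReal.ofReal_mul (Real.exp_pos _).le, ← ENNReal.ofReal_mul (Real.exp_pos _).le,
          ← mul_assoc, ← Real.exp_add]
        ring_nf
    _ ≤ ENNReal.ofReal (Real.exp (n * (t - ε))) * (ENNReal.ofReal (Real.exp (-(n * (D + ε)))) *
          (ENNReal.ofReal (Real.exp (n * (D + ε))) * pmeas μ n (G n))) := by
        gcongr
        exact h1.trans hle
    _ = ENNReal.ofReal (Real.exp (n * (t - ε))) * pmeas μ n (G n) := by
        rw [← mul_assoc (ENNReal.ofReal (Real.exp (-(n * (D + ε))))),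
          ← ENNReal.ofReal_mul (Real.exp_pos _).le, ← Real.exp_add]
        simp
    _ ≤ _ := hge

theorem isClosed_setOf_KL_le (μ : ProbabilityMeasure Ω2) (B : ℝ≥0∞) :
    IsClosed {ρ : ProbabilityMeasure Ω2 | KL ρ μ ≤ B} := by
  rw [← isOpen_compl_iff, isOpen_iff_mem_nhds]
  intro ν hν
  have hν : B < KL ν μ := not_le.1 hν
  obtain ⟨f, hf1, hf2⟩ := exists_dual_of_lt_KL (ν : Measure Ω2) μ (b := B.toReal)
    (by rwa [ENNReal.ofReal_toReal hν.ne_top])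
  filter_upwards [(isOpen_setOf_lt_integral f _).mem_nhds hf2] with ρ hρ
  refine not_le.2 (lt_of_lt_of_le ?_ (ofReal_integral_le_KL (ρ : Measure Ω2) μ f hf1))
  rw [← ENNReal.ofReal_toReal hν.ne_top]
  exact (ENNReal.ofReal_lt_ofReal_iff_of_nonneg ENNReal.toReal_nonneg).2 hρ

section FreeEnergy

variable {k : ℕ} (σ : Equiv.Perm (Fin k)) {μ : ProbabilityMeasure Ω2} (θ : ℝ)

theorem lt_freeEnergy_iff {ν : ProbabilityMeasure Ω2} {c : ℝ} :
    (c : EReal) < freeEnergy σ μ θ ν ↔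
      ((c + θ * tPat σ (ν : Measure Ω2) : ℝ) : EReal) < ((KL ν μ : ℝ≥0∞) : EReal) := by
  rw [freeEnergy, EReal.lt_sub_iff_add_lt (by simp) (by simp), EReal.coe_add]

theorem eventually_lt_freeEnergy {ν : ProbabilityMeasure Ω2} (hν : ν ∈ Mcal) {c : ℝ}
    (h : (c : EReal) < freeEnergy σ μ θ ν) : ∀ᶠ ρ in 𝓝 ν, (c : EReal) < freeEnergy σ μ θ ρ := by
  obtain ⟨b, hb1, hb2⟩ := EReal.lt_iff_exists_real_btwn.1 ((lt_freeEnergy_iff σ θ).1 h)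
  rw [EReal.coe_lt_coe_iff] at hb1
  obtain ⟨f, hf1, hf2⟩ := exists_dual_of_coe_lt_KL (ν : Measure Ω2) μ hb2
  have ht : ∀ᶠ ρ in 𝓝 ν, θ * tPat σ ((ρ : ProbabilityMeasure Ω2) : Measure Ω2) < b - c :=
    (continuousAt_tPat σ hν).const_mul θ |>.eventually_lt_const (by linarith)
  filter_upwards [ht, (isOpen_setOf_lt_integral f b).mem_nhds hf2] with ρ h1 h2
  have h2 : b < ∫ p, f p ∂(ρ : Measure Ω2) := h2
  rw [lt_freeEnergy_iff]
  calc ((c + θ * tPat σ (ρ : Measure Ω2) : ℝ) : EReal)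
      < ((∫ p, f p ∂(ρ : Measure Ω2) : ℝ) : EReal) := by
        rw [EReal.coe_lt_coe_iff]; linarith
    _ ≤ ((ENNReal.ofReal (∫ p, f p ∂(ρ : Measure Ω2)) : ℝ≥0∞) : EReal) := by
        rw [EReal.coe_ennreal_ofReal, EReal.coe_le_coe_iff]; exact le_max_left _ _
    _ ≤ _ := EReal.coe_ennreal_le_coe_ennreal_iff.2
        (ofReal_integral_le_KL (ρ : Measure Ω2) μ f hf1)

theorem isCompact_setOf_freeEnergy_le (hμ : μ ∈ Mcal) (c : ℝ) :
    IsCompact {ν | ν ∈ Mcal ∧ freeEnergy σ μ θ ν ≤ c} := by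
  have hS : IsClosed (Pcal ∩ {ρ | KL ρ μ ≤ ENNReal.ofReal (c + |θ|)}) :=
    isCompact_Pcal.isClosed.inter (isClosed_setOf_KL_le μ _)
  have hsub : {ν | ν ∈ Mcal ∧ freeEnergy σ μ θ ν ≤ c} ⊆
      Pcal ∩ {ρ | KL ρ μ ≤ ENNReal.ofReal (c + |θ|)} := by
    rintro ν ⟨hν, hle⟩
    refine ⟨hν.1, ?_⟩
    rw [← not_lt, lt_freeEnergy_iff, not_lt] at hle
    change KL ν μ ≤ _
    rw [← EReal.coe_ennreal_le_coe_ennreal_iff, EReal.coe_ennreal_ofReal]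
    refine hle.trans (EReal.coe_le_coe_iff.2 (le_max_of_le_left ?_))
    gcongr
    exact (le_abs_self _).trans (abs_mul_tPat_le σ θ (ν : Measure Ω2))
  refine isCompact_Pcal.of_isClosed_subset ?_ (hsub.trans Set.inter_subset_left)
  rw [← isOpen_compl_iff, isOpen_iff_mem_nhds]
  intro ν hν
  by_cases hνS : ν ∈ Pcal ∩ {ρ | KL ρ μ ≤ ENNReal.ofReal (c + |θ|)}
  · have hM : ν ∈ Mcal := by
      by_contra hM
      have h2 : KL ν μ ≤ ENNReal.ofReal (c + |θ|) := hνS.2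
      rw [KL_eq_top_of_notMem_Mcal hμ hνS.1 hM] at h2
      exact ENNReal.ofReal_ne_top (top_le_iff.1 h2)
    have hlt : (c : EReal) < freeEnergy σ μ θ ν := not_le.1 fun h => hν ⟨hM, h⟩
    filter_upwards [eventually_lt_freeEnergy σ θ hM hlt] with ρ hρ hmem
    exact hρ.not_ge hmem.2
  · filter_upwards [hS.isOpen_compl.mem_nhds hνS] with ρ hρ hmem
    exact hρ (hsub hmem)

theorem exists_iInf_freeEnergy_eq_coe (hμ : μ ∈ Mcal) :
    ∃ m : ℝ, ⨅ ν ∈ Mcal, freeEnergy σ μ θ ν = m := by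
  have h1 : ((-|θ| : ℝ) : EReal) ≤ ⨅ ν ∈ Mcal, freeEnergy σ μ θ ν := by
    refine le_iInf₂ fun ν _ => ?_
    have : ((-|θ| : ℝ) : EReal) = 0 - ((|θ| : ℝ) : EReal) := by simp
    rw [this]
    refine EReal.sub_le_sub (EReal.coe_ennreal_nonneg _) (EReal.coe_le_coe_iff.2 ?_)
    exact (le_abs_self _).trans (abs_mul_tPat_le σ θ (ν : Measure Ω2))
  have hK : KL (μ : Measure Ω2) μ = 0 := by
    rw [KL_eq_klDiv, InformationTheory.klDiv_self]
  have h2 : ⨅ ν ∈ Mcal, freeEnergy σ μ θ ν ≤ ((-(θ * tPat σ (μ : Measure Ω2)) : ℝ) : EReal) := by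
    refine (iInf₂_le μ hμ).trans (le_of_eq ?_)
    rw [freeEnergy, hK]
    simp
  exact ⟨_, (EReal.coe_toReal (ne_top_of_le_ne_top (EReal.coe_ne_top _) h2)
    (ne_bot_of_le_ne_bot (EReal.coe_ne_bot _) h1)).symm⟩

variable {θ}

theorem Igibbs_lt_iff {m : ℝ} (hm : ⨅ ν ∈ Mcal, freeEnergy σ μ θ ν = m)
    {γ : ProbabilityMeasure Ω2} {c : ℝ} :
    Igibbs σ μ θ γ < c ↔ ∃ ν ∈ Mcal, OmapP ν = γ ∧ freeEnergy σ μ θ ν < ((c + m : ℝ) : EReal) := by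
  by_cases hγ : γ ∈ Mtilde
  · have hI : Igibbs σ μ θ γ =
        (⨅ ν ∈ {ν : ProbabilityMeasure Ω2 | ν ∈ Mcal ∧ Omap ↑ν = (γ : Measure Ω2)},
          freeEnergy σ μ θ ν) - ⨅ ν ∈ Mcal, freeEnergy σ μ θ ν := if_pos hγ
    rw [hI, hm, EReal.sub_lt_iff (by simp) (by simp), ← EReal.coe_add]
    simp only [iInf_lt_iff, exists_prop]
    refine ⟨?_, ?_⟩
    · rintro ⟨ν, ⟨hν, hO⟩, hlt⟩
      exact ⟨ν, hν, Subtype.ext hO, hlt⟩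
    · rintro ⟨ν, hν, hO, hlt⟩
      exact ⟨ν, ⟨hν, congrArg Subtype.val hO⟩, hlt⟩
  · have hI : Igibbs σ μ θ γ = ⊤ := if_neg hγ
    rw [hI]
    refine iff_of_false not_top_lt ?_
    rintro ⟨ν, hν, rfl, -⟩
    exact hγ (OmapP_mem_Mtilde hν)

theorem Igibbs_nonneg {m : ℝ} (hm : ⨅ ν ∈ Mcal, freeEnergy σ μ θ ν = m)
    (γ : ProbabilityMeasure Ω2) : 0 ≤ Igibbs σ μ θ γ := by
  rw [← not_lt, ← EReal.coe_zero, Igibbs_lt_iff σ hm]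
  rintro ⟨ν, hν, -, hlt⟩
  rw [zero_add, ← hm] at hlt
  exact hlt.not_ge (iInf₂_le ν hν)

theorem isCompact_setOf_Igibbs_le (hμ : μ ∈ Mcal) (c : ℝ) :
    IsCompact {γ | Igibbs σ μ θ γ ≤ c} := by
  obtain ⟨m, hm⟩ := exists_iInf_freeEnergy_eq_coe σ θ hμ
  have hK (c' : ℝ) :
      IsCompact (OmapP '' {ν | ν ∈ Mcal ∧ freeEnergy σ μ θ ν ≤ ((c' + m : ℝ) : EReal)}) :=
    (isCompact_setOf_freeEnergy_le σ θ hμ _).image_of_continuousOn fun ν hν =>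
      (continuousWithinAt_OmapP hν.1).mono fun ρ hρ => hρ.1.1
  have heq : {γ | Igibbs σ μ θ γ ≤ c} = ⋂ c' ∈ Set.Ioi c,
      OmapP '' {ν | ν ∈ Mcal ∧ freeEnergy σ μ θ ν ≤ ((c' + m : ℝ) : EReal)} := by
    ext γ
    simp only [Set.mem_ofPred_eq, Set.mem_iInter]
    refine ⟨fun h c' hc' => ?_, fun h => ?_⟩
    · obtain ⟨ν, hν, hO, hlt⟩ := (Igibbs_lt_iff σ hm).1 (h.trans_lt (EReal.coe_lt_coe_iff.2 hc'))
      exact ⟨ν, ⟨hν, hlt.le⟩, hO⟩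
    · refine EReal.le_of_forall_lt_iff_le.1 fun d hd => ?_
      obtain ⟨c', hc1, hc2⟩ := exists_between (EReal.coe_lt_coe_iff.1 hd)
      obtain ⟨ν, ⟨hν, hle⟩, hO⟩ := h c' hc1
      exact ((Igibbs_lt_iff σ hm).2 ⟨ν, hν, hO, hle.trans_lt
        (EReal.coe_lt_coe_iff.2 (by linarith))⟩).le
  rw [heq]
  refine (hK (c + 1)).of_isClosed_subset (isClosed_biInter fun c' _ => (hK c').isClosed)
    (Set.biInter_subset_of_mem (Set.mem_Ioi.2 (lt_add_one c)))

theorem lowerSemicontinuous_Igibbs (hμ : μ ∈ Mcal) : LowerSemicontinuous (Igibbs σ μ θ) := by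
  obtain ⟨m, hm⟩ := exists_iInf_freeEnergy_eq_coe σ θ hμ
  refine lowerSemicontinuous_iff_isClosed_preimage.2 fun y => ?_
  induction y with
  | bot =>
    have : Igibbs σ μ θ ⁻¹' Set.Iic ⊥ = ∅ := by
      ext γ
      have h0 := Igibbs_nonneg σ hm γ
      simp only [Set.mem_preimage, Set.mem_Iic, le_bot_iff, Set.mem_empty_iff_false, iff_false]
      exact fun h => absurd (h ▸ h0) (by simp)
    rw [this]
    exact isClosed_empty
  | coe c => exact (isCompact_setOf_Igibbs_le σ hμ c).isClosed
  | top => simp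

end FreeEnergy

theorem Qgibbs_eq_div {k : ℕ} (σ : Equiv.Perm (Fin k)) (μ : ProbabilityMeasure Ω2) (θ : ℝ) (n : ℕ)
    (A : Set (ProbabilityMeasure Ω2)) :
    Qgibbs σ μ θ n {z | EmP (inducedPerm z) ∈ A} =
      gibbsWeight σ μ θ n A / gibbsWeight σ μ θ n Set.univ := by
  have hbd : ∀ z : Fin n → Ω2, |n * θ * tPerm σ (inducedPerm z)| ≤
      ∑ π : Equiv.Perm (Fin n), |n * θ * tPerm σ π| := fun z =>
    Finset.single_le_sum (f := fun π => |n * θ * tPerm σ π|) (fun _ _ => abs_nonneg _)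
      (Finset.mem_univ (inducedPerm z))
  have hint : Integrable (fun z => Real.exp (n * θ * tPerm σ (inducedPerm z))) (pmeas μ n) :=
    integrable_exp_of_abs_le (measurable_comp_inducedPerm fun π => n * θ * tPerm σ π) hbd
  have hpos : 0 < ∫ z, Real.exp (n * θ * tPerm σ (inducedPerm z)) ∂(pmeas μ n) :=
    integral_exp_pos hint
  have hZ : gibbsWeight σ μ θ n Set.univ =
      ENNReal.ofReal (∫ z, Real.exp (n * θ * tPerm σ (inducedPerm z)) ∂(pmeas μ n)) := by
    rw [ofReal_integral_eq_lintegral_ofReal hint (ae_of_all _ fun _ => (Real.exp_pos _).le)]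
    simp [gibbsWeight]
  have hA : MeasurableSet {z : Fin n → Ω2 | EmP (inducedPerm z) ∈ A} :=
    measurableSet_inducedPerm {π | EmP π ∈ A}
  rw [hZ, Qgibbs, withDensity_apply _ hA, gibbsWeight,
    div_eq_mul_inv, ← lintegral_mul_const _
      (measurable_comp_inducedPerm fun π => ENNReal.ofReal (Real.exp (n * θ * tPerm σ π)))]
  refine lintegral_congr fun z => ?_
  rw [← ENNReal.ofReal_inv_of_pos hpos, ← ENNReal.ofReal_mul (Real.exp_pos _).le, Real.exp_sub, Fn,
    Real.exp_log hpos, div_eq_mul_inv]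

theorem log_ofReal_exp (x : ℝ) : ENNReal.log (ENNReal.ofReal (Real.exp x)) = x := by
  rw [ENNReal.log_ofReal_of_pos (Real.exp_pos x), Real.log_exp]

theorem tendsto_inv_mul_log_ofReal_exp (r s : ℝ) :
    Tendsto (fun n : ℕ => (((n : ℝ)⁻¹ : ℝ) : EReal) *
      ENNReal.log (ENNReal.ofReal (Real.exp (r + n * s)))) atTop (𝓝 (s : EReal)) := by
  simp_rw [log_ofReal_exp, ← EReal.coe_mul]
  refine (continuous_coe_real_ereal.tendsto s).comp ?_
  have h : Tendsto (fun n : ℕ => (n : ℝ)⁻¹ * r + s) atTop (𝓝 (0 * r + s)) :=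
    (tendsto_inv_atTop_nhds_zero_nat.mul_const r).add_const s
  rw [zero_mul, zero_add] at h
  refine h.congr' ?_
  filter_upwards [eventually_ne_atTop 0] with n hn
  field_simp

theorem limsup_inv_mul_log_le {q : ℕ → ℝ≥0∞} {r s : ℝ}
    (h : ∀ᶠ n : ℕ in atTop, q n ≤ ENNReal.ofReal (Real.exp (r + n * s))) :
    limsup (fun n : ℕ => (((n : ℝ)⁻¹ : ℝ) : EReal) * ENNReal.log (q n)) atTop ≤ s := by
  rw [← (tendsto_inv_mul_log_ofReal_exp r s).limsup_eq]
  refine limsup_le_limsup (h.mono fun n hn => ?_)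
  exact mul_le_mul_of_nonneg_left (ENNReal.log_monotone hn)
    (EReal.coe_nonneg.2 (by positivity))

theorem le_liminf_inv_mul_log {q : ℕ → ℝ≥0∞} {r s : ℝ}
    (h : ∀ᶠ n : ℕ in atTop, ENNReal.ofReal (Real.exp (r + n * s)) ≤ q n) :
    s ≤ liminf (fun n : ℕ => (((n : ℝ)⁻¹ : ℝ) : EReal) * ENNReal.log (q n)) atTop := by
  rw [← (tendsto_inv_mul_log_ofReal_exp r s).liminf_eq]
  refine liminf_le_liminf (h.mono fun n hn => ?_)
  exact mul_le_mul_of_nonneg_left (ENNReal.log_monotone hn)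
    (EReal.coe_nonneg.2 (by positivity))

theorem ofReal_exp_div_ofReal_exp (x y : ℝ) :
    ENNReal.ofReal (Real.exp x) / ENNReal.ofReal (Real.exp y) = ENNReal.ofReal (Real.exp (x - y)) := by
  rw [Real.exp_sub, ENNReal.ofReal_div_of_pos (Real.exp_pos y)]

theorem gibbsWeight_mono {k : ℕ} (σ : Equiv.Perm (Fin k)) (μ : Measure Ω2) (θ : ℝ) (n : ℕ)
    {A B : Set (ProbabilityMeasure Ω2)} (h : A ⊆ B) :
    gibbsWeight σ μ θ n A ≤ gibbsWeight σ μ θ n B :=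
  lintegral_mono_set fun _ hz => h hz

theorem gibbsWeight_le_exp_of_isClosed {k : ℕ} (σ : Equiv.Perm (Fin k)) {μ : ProbabilityMeasure Ω2}
    (hμ : μ ∈ Mcal) (θ : ℝ) {C : Set (ProbabilityMeasure Ω2)} (hC : IsClosed C) {a : ℝ}
    (h : ∀ ν ∈ Mcal, OmapP ν ∈ C → (a : EReal) < freeEnergy σ μ θ ν) :
    ∃ r : ℝ, ∀ᶠ n : ℕ in atTop,
      gibbsWeight σ μ θ n C ≤ ENNReal.ofReal (Real.exp (r - n * a)) := by
  obtain ⟨M, hM⟩ := gibbsWeight_le_of_isClosed σ hμ θ hC h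
  refine ⟨M, ?_⟩
  filter_upwards [eventually_ne_atTop 0] with n hn
  refine (hM n hn).trans ?_
  rw [sub_eq_add_neg, Real.exp_add, ENNReal.ofReal_mul (Real.exp_pos _).le]
  gcongr
  rw [← ENNReal.ofReal_coe_nnreal]
  exact ENNReal.ofReal_le_ofReal (by linarith [Real.add_one_le_exp (M : ℝ)])

theorem limsup_log_Qgibbs_le {k : ℕ} (σ : Equiv.Perm (Fin k)) {μ : ProbabilityMeasure Ω2}
    (hμ : μ ∈ Mcal) (θ : ℝ) (A : Set (ProbabilityMeasure Ω2)) :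
    limsup (fun n : ℕ => (((n : ℝ)⁻¹ : ℝ) : EReal) *
        ENNReal.log (Qgibbs σ μ θ n {z | EmP (inducedPerm z) ∈ A})) atTop ≤
      -(⨅ γ ∈ closure A, Igibbs σ μ θ γ) := by
  obtain ⟨m, hm⟩ := exists_iInf_freeEnergy_eq_coe σ θ hμ
  refine EReal.le_of_forall_lt_iff_le.1 fun s hs => ?_
  obtain ⟨s', hs1, hs2⟩ := EReal.lt_iff_exists_real_btwn.1 hs
  rw [EReal.coe_lt_coe_iff] at hs2
  have hlow : ∀ ν ∈ Mcal, OmapP ν ∈ closure A →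
      ((m - s' - (s - s') / 2 : ℝ) : EReal) < freeEnergy σ μ θ ν := by
    intro ν hν hO
    have h1 : ¬ Igibbs σ μ θ (OmapP ν) < ((-s' : ℝ) : EReal) := by
      rw [not_lt, EReal.coe_neg, EReal.neg_le]
      refine le_trans ?_ hs1.le
      exact EReal.neg_le_neg_iff.2 (iInf₂_le _ hO)
    rw [Igibbs_lt_iff σ hm] at h1
    have h2 : ((-s' + m : ℝ) : EReal) ≤ freeEnergy σ μ θ ν :=
      not_lt.1 fun h => h1 ⟨ν, hν, rfl, h⟩
    exact lt_of_lt_of_le (EReal.coe_lt_coe_iff.2 (by linarith)) h2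
  obtain ⟨r, hr⟩ := gibbsWeight_le_exp_of_isClosed σ hμ θ isClosed_closure hlow
  have hlt : ⨅ ν ∈ Mcal, freeEnergy σ μ θ ν < ((m + (s - s') / 2 : ℝ) : EReal) := by
    rw [hm, EReal.coe_lt_coe_iff]; linarith
  simp only [iInf_lt_iff] at hlt
  obtain ⟨ν, hν, hlt⟩ := hlt
  refine limsup_inv_mul_log_le (r := r) ?_
  filter_upwards [hr, le_gibbsWeight_of_isOpen σ θ isOpen_univ hν trivial hlt] with n h1 h2
  rw [Qgibbs_eq_div]
  refine (ENNReal.div_le_div ((gibbsWeight_mono σ μ θ n subset_closure).trans h1) h2).trans ?_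
  rw [ofReal_exp_div_ofReal_exp]
  exact le_of_eq (by ring_nf)

theorem le_liminf_log_Qgibbs {k : ℕ} (σ : Equiv.Perm (Fin k)) {μ : ProbabilityMeasure Ω2}
    (hμ : μ ∈ Mcal) (θ : ℝ) (A : Set (ProbabilityMeasure Ω2)) :
    -(⨅ γ ∈ interior A, Igibbs σ μ θ γ) ≤
      liminf (fun n : ℕ => (((n : ℝ)⁻¹ : ℝ) : EReal) *
        ENNReal.log (Qgibbs σ μ θ n {z | EmP (inducedPerm z) ∈ A})) atTop := by
  obtain ⟨m, hm⟩ := exists_iInf_freeEnergy_eq_coe σ θ hμ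
  refine EReal.ge_of_forall_gt_iff_ge.1 fun s hs => ?_
  obtain ⟨s', hs1, hs2⟩ := EReal.lt_iff_exists_real_btwn.1 hs
  rw [EReal.coe_lt_coe_iff] at hs1
  rw [EReal.lt_neg_comm, ← EReal.coe_neg] at hs2
  simp only [iInf_lt_iff] at hs2
  obtain ⟨γ, hγ, hlt⟩ := hs2
  obtain ⟨ν, hν, rfl, hfe⟩ := (Igibbs_lt_iff σ hm).1 hlt
  have hlow : ∀ ρ ∈ Mcal, OmapP ρ ∈ Set.univ →
      ((m - (s' - s) : ℝ) : EReal) < freeEnergy σ μ θ ρ := fun ρ hρ _ =>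
    lt_of_lt_of_le (EReal.coe_lt_coe_iff.2 (by linarith)) (hm.symm.le.trans (iInf₂_le ρ hρ))
  obtain ⟨r, hr⟩ := gibbsWeight_le_exp_of_isClosed σ hμ θ isClosed_univ hlow
  refine le_liminf_inv_mul_log (r := -r) ?_
  filter_upwards [hr, le_gibbsWeight_of_isOpen σ θ isOpen_interior hν hγ hfe] with n h1 h2
  rw [Qgibbs_eq_div]
  refine le_trans ?_ (ENNReal.div_le_div (h2.trans (gibbsWeight_mono σ μ θ n interior_subset)) h1)
  rw [ofReal_exp_div_ofReal_exp]
  exact le_of_eq (by ring_nf)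

/-- Theorem 1.9 (iii): `I_{σ,μ,θ}` is a good rate function, and the Gibbs
random permutations `π_{n,σ,μ,θ}` satisfy an LDP with speed `n` and rate `I_{σ,μ,θ}`. -/
theorem ldp_gibbs_permutations {k : ℕ} (σ : Equiv.Perm (Fin k)) (μ : ProbabilityMeasure Ω2)
    (hμ : μ ∈ Mcal) (θ : ℝ) :
    (LowerSemicontinuous (Igibbs σ (↑μ) θ) ∧
      ∀ c : ℝ, IsCompact {γ : ProbabilityMeasure Ω2 | Igibbs σ (↑μ) θ γ ≤ (c : EReal)}) ∧
    ∀ A : Set (ProbabilityMeasure Ω2), MeasurableSet[borel (ProbabilityMeasure Ω2)] A →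
      (-(⨅ γ ∈ interior A, Igibbs σ (↑μ) θ γ) ≤
          liminf (fun n : ℕ => (((n : ℝ)⁻¹ : ℝ) : EReal) *
            ENNReal.log (Qgibbs σ (↑μ) θ n {z | EmP (inducedPerm z) ∈ A})) atTop) ∧
      limsup (fun n : ℕ => (((n : ℝ)⁻¹ : ℝ) : EReal) *
            ENNReal.log (Qgibbs σ (↑μ) θ n {z | EmP (inducedPerm z) ∈ A})) atTop ≤
        -(⨅ γ ∈ closure A, Igibbs σ (↑μ) θ γ) := by
  exact ⟨⟨lowerSemicontinuous_Igibbs σ hμ, isCompact_setOf_Igibbs_le σ hμ⟩, fun A _ =>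
    ⟨le_liminf_log_Qgibbs σ hμ θ A, limsup_log_Qgibbs_le σ hμ θ A⟩⟩

end
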